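/- arXiv:2207.06331 — 7 statements merged into one kernel-verified Lean document; each statement's English description precedes it below -/
import Mathlib

section
/- For every ν ∈ ℝ and every x > 0, K_ν(x) = (2^(ν−1)/x^ν) ∫_0^∞ e^{−s} ( ∫_{x²/(4s)}^∞ e^{−u} u^(ν−1) du ) ds. -/
/-- The Macdonald function (modified Bessel function of the second kind):
`K_ν(x) = (x^ν / 2^(ν+1)) ∫_0^∞ exp(−t − x²/(4t)) t^(−ν−1) dt` for `x > 0`. -/
noncomputable def besselK (ν x : ℝ) : ℝ :=
  x ^ ν / 2 ^ (ν + 1) *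
    ∫ t in Set.Ioi (0 : ℝ), Real.exp (-t - x ^ 2 / (4 * t)) * t ^ (-ν - 1)

open MeasureTheory Set

/-- The integrand of the upper incomplete Gamma function is integrable away from zero. -/
lemma integrableOn_exp_neg_mul_rpow_Ioi (ν : ℝ) {a : ℝ} (ha : 0 < a) :
    IntegrableOn (fun u : ℝ => Real.exp (-u) * u ^ (ν - 1)) (Ioi a) := by
  refine integrable_of_isBigO_exp_neg (b := 1 / 2) (by norm_num) ?_ ?_
  · refine ContinuousOn.mul (by fun_prop) ?_
    exact ContinuousOn.rpow_const continuousOn_id fun u hu => Or.inl (ha.trans_le hu).ne'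
  · exact (Real.Gamma_integrand_isLittleO (ν - 1)).isBigO

lemma lintegral_exp_neg_Ioi (a : ℝ) :
    ∫⁻ s in Ioi a, ENNReal.ofReal (Real.exp (-s)) = ENNReal.ofReal (Real.exp (-a)) := by
  rw [← integral_exp_neg_Ioi a, ofReal_integral_eq_lintegral_ofReal]
  · exact integrableOn_exp_neg_Ioi a
  · exact ae_of_all _ fun s => (Real.exp_pos _).le

/-- Tonelli for the region `c < s * u` in the positive quadrant. -/
lemma integral_exp_neg_mul_upperGamma (ν : ℝ) {c : ℝ} (hc : 0 < c) :
    ∫ s in Ioi (0 : ℝ), Real.exp (-s) * ∫ u in Ioi (c / s), Real.exp (-u) * u ^ (ν - 1) =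
      ∫ u in Ioi (0 : ℝ), Real.exp (-u - c / u) * u ^ (ν - 1) := by
  set g : ℝ → ℝ := fun u => Real.exp (-u) * u ^ (ν - 1) with hg
  have hg_meas : Measurable g := by fun_prop
  have hg_nonneg : ∀ u, 0 < u → 0 ≤ g u := fun u hu => by positivity
  set F : ℝ → ℝ → ENNReal := fun s u =>
    {p : ℝ × ℝ | c < p.1 * p.2}.indicator
      (fun p => ENNReal.ofReal (Real.exp (-p.1)) * ENNReal.ofReal (g p.2)) (s, u) with hF
  have hF_meas : Measurable (Function.uncurry F) := by
    refine Measurable.indicator (by fun_prop) ?_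
    exact measurableSet_lt measurable_const (by fun_prop)
  have h_left : ∀ s ∈ Ioi (0 : ℝ),
      ENNReal.ofReal (Real.exp (-s) * ∫ u in Ioi (c / s), g u) =
        ∫⁻ u in Ioi (0 : ℝ), F s u := by
    intro s hs
    have hs' : 0 < s := hs
    have hcs : 0 < c / s := by positivity
    have h_eq : (fun u => F s u) = (Ioi (c / s)).indicator
        (fun u => ENNReal.ofReal (Real.exp (-s)) * ENNReal.ofReal (g u)) := by
      ext u
      simp only [hF, indicator, mem_ofPred_eq, mem_Ioi, div_lt_iff₀' hs']
    rw [h_eq, setLIntegral_indicator measurableSet_Ioi,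
      inter_eq_left.2 (Ioi_subset_Ioi hcs.le), lintegral_const_mul _ (by fun_prop),
      ENNReal.ofReal_mul (Real.exp_pos _).le, ofReal_integral_eq_lintegral_ofReal]
    · exact integrableOn_exp_neg_mul_rpow_Ioi ν hcs
    · exact (ae_restrict_iff' measurableSet_Ioi).2
        (ae_of_all _ fun u hu => hg_nonneg u (hcs.trans hu))
  have h_right : ∀ u ∈ Ioi (0 : ℝ),
      ∫⁻ s in Ioi (0 : ℝ), F s u =
        ENNReal.ofReal (Real.exp (-u - c / u) * u ^ (ν - 1)) := by
    intro u hu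
    have hu' : 0 < u := hu
    have hcu : 0 < c / u := by positivity
    have h_eq : (fun s => F s u) = (Ioi (c / u)).indicator
        (fun s => ENNReal.ofReal (Real.exp (-s)) * ENNReal.ofReal (g u)) := by
      ext s
      simp only [hF, indicator, mem_ofPred_eq, mem_Ioi, div_lt_iff₀ hu']
    rw [h_eq, setLIntegral_indicator measurableSet_Ioi,
      inter_eq_left.2 (Ioi_subset_Ioi hcu.le), lintegral_mul_const _ (by fun_prop),
      lintegral_exp_neg_Ioi, ← ENNReal.ofReal_mul (Real.exp_pos _).le, hg, ← mul_assoc,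
      ← Real.exp_add, neg_add_eq_sub]
  have h_swap : ∫⁻ s in Ioi (0 : ℝ), ENNReal.ofReal (Real.exp (-s) * ∫ u in Ioi (c / s), g u) =
      ∫⁻ u in Ioi (0 : ℝ), ENNReal.ofReal (Real.exp (-u - c / u) * u ^ (ν - 1)) := by
    rw [setLIntegral_congr_fun measurableSet_Ioi h_left,
      lintegral_lintegral_swap hF_meas.aemeasurable,
      setLIntegral_congr_fun measurableSet_Ioi h_right]
  have h_inner_meas : AEStronglyMeasurable
      (fun s => Real.exp (-s) * ∫ u in Ioi (c / s), g u) (volume.restrict (Ioi 0)) := by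
    have h_toReal : Measurable fun s => (∫⁻ u in Ioi (0 : ℝ), F s u).toReal :=
      hF_meas.lintegral_prod_right'.ennreal_toReal
    refine h_toReal.aestronglyMeasurable.congr ?_
    refine (ae_restrict_iff' measurableSet_Ioi).2 (ae_of_all _ fun s hs => ?_)
    dsimp only
    rw [← h_left s hs, ENNReal.toReal_ofReal]
    have hs' : 0 < s := hs
    exact mul_nonneg (Real.exp_pos _).le (setIntegral_nonneg measurableSet_Ioi fun u hu =>
      hg_nonneg u (lt_trans (by positivity) hu))
  rw [integral_eq_lintegral_of_nonneg_ae _ h_inner_meas, integral_eq_lintegral_of_nonneg_ae, h_swap]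
  · refine (ae_restrict_iff' measurableSet_Ioi).2 (ae_of_all _ fun u hu => ?_)
    have hu' : 0 < u := hu
    simp only [Pi.zero_apply]
    positivity
  · exact Measurable.aestronglyMeasurable (by fun_prop)
  · refine (ae_restrict_iff' measurableSet_Ioi).2 (ae_of_all _ fun s hs => ?_)
    have hs' : 0 < s := hs
    exact mul_nonneg (Real.exp_pos _).le (setIntegral_nonneg measurableSet_Ioi fun u hu =>
      hg_nonneg u (lt_trans (by positivity) hu))

/-- The substitution `t = c / u`. -/
lemma integral_exp_neg_sub_div_mul_rpow (ν : ℝ) {c : ℝ} (hc : 0 < c) :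
    ∫ t in Ioi (0 : ℝ), Real.exp (-t - c / t) * t ^ (-ν - 1) =
      c ^ (-ν) * ∫ u in Ioi (0 : ℝ), Real.exp (-u - c / u) * u ^ (ν - 1) := by
  have h_scale := integral_comp_mul_left_Ioi
    (fun t : ℝ => Real.exp (-t - c / t) * t ^ (-ν - 1)) 0 hc
  rw [mul_zero, eq_inv_smul_iff₀ hc.ne', smul_eq_mul] at h_scale
  rw [← h_scale, ← integral_comp_rpow_Ioi _ (show (-1 : ℝ) ≠ 0 by norm_num),
    ← integral_const_mul, ← integral_const_mul]
  refine setIntegral_congr_fun measurableSet_Ioi fun u hu => ?_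
  have hu' : 0 < u := hu
  have h_exp : -(c * u⁻¹) - c / (c * u⁻¹) = -u - c / u := by
    field_simp
    ring
  have h_c : c * c ^ (-ν - 1) = c ^ (-ν) := by
    rw [Real.rpow_sub_one hc.ne']
    field_simp
  have h_u : u ^ (-1 - 1 : ℝ) * u⁻¹ ^ (-ν - 1) = u ^ (ν - 1) := by
    rw [← Real.rpow_neg_one u, ← Real.rpow_mul hu'.le, ← Real.rpow_add hu']
    ring_nf
  simp only [Real.rpow_neg_one, smul_eq_mul, abs_neg, abs_one, one_mul]
  rw [h_exp, Real.mul_rpow hc.le (by positivity), ← h_c, ← h_u]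
  ring

/-- For every `ν ∈ ℝ` and `x > 0`,
`K_ν(x) = (2^(ν−1)/x^ν) ∫_0^∞ e^{−s} ( ∫_{x²/(4s)}^∞ e^{−u} u^(ν−1) du ) ds`. -/
theorem besselK_double_integral_rep (ν x : ℝ) (hx : 0 < x) :
    besselK ν x =
      2 ^ (ν - 1) / x ^ ν *
        ∫ s in Set.Ioi (0 : ℝ), Real.exp (-s) *
          ∫ u in Set.Ioi (x ^ 2 / (4 * s)), Real.exp (-u) * u ^ (ν - 1) := by
  have hc : 0 < x ^ 2 / 4 := by positivity
  have h_const : x ^ ν / 2 ^ (ν + 1) * (x ^ 2 / 4) ^ (-ν) = 2 ^ (ν - 1) / x ^ ν := by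
    have h_sq : x ^ 2 / 4 = (x / 2) * (x / 2) := by ring
    rw [h_sq, Real.rpow_neg (by positivity), Real.mul_rpow (by positivity) (by positivity),
      Real.div_rpow hx.le (by norm_num), Real.rpow_add_one (by norm_num),
      Real.rpow_sub_one (by norm_num)]
    field_simp
  simp only [besselK, ← div_div]
  rw [integral_exp_neg_sub_div_mul_rpow ν hc, ← mul_assoc, h_const,
    integral_exp_neg_mul_upperGamma ν hc]
end

section
/- For every α ≥ 0, every ε > 0, and every x > 0, R_{α+ε}(x) − R_α(x) = 2(2α+ε) ∫_0^∞ [ K_{2α+ε}(2x cosh t) / (K_{α+ε}(x) K_α(x)) ] · sinh(εt) · tanh(t) dt. -/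
/-- `R_α(x) = α + x·K_{1−α}(x)/K_α(x)` for `x > 0`, and `R_α(0) = α`. -/
noncomputable def besselR (α x : ℝ) : ℝ :=
  if x = 0 then α else α + x * besselK (1 - α) x / besselK α x

open MeasureTheory Real Set

/-- The quadratic lower bound for the hyperbolic cosine. -/
lemma one_add_sq_div_two_le_cosh (u : ℝ) : 1 + u ^ 2 / 2 ≤ cosh u := by
  have h1 : |u / 2| ≤ |sinh (u / 2)| := by
    rw [abs_sinh]
    exact self_le_sinh_iff.mpr (abs_nonneg _)
  have h2 : cosh u = cosh (u / 2) ^ 2 + sinh (u / 2) ^ 2 := by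
    rw [← cosh_two_mul]; congr 1; ring
  have h3 := sq_le_sq.mpr h1
  rw [h2, cosh_sq]
  nlinarith

lemma integrable_exp_neg_mul_sq_add_mul {c : ℝ} (hc : 0 < c) (a : ℝ) :
    Integrable fun u : ℝ => exp (-c * u ^ 2 + a * u) := by
  have h := ((integrable_exp_neg_mul_sq hc).comp_sub_right (a / (2 * c))).const_mul
    (exp (a ^ 2 / (4 * c)))
  refine h.congr (Filter.Eventually.of_forall fun u => ?_)
  simp only [← exp_add]
  congr 1
  field_simp
  ring

/-- The exponential of a continuous function on the plane with a negative definite quadratic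
upper bound is integrable. -/
lemma integrable_exp_of_le_quadratic {g : ℝ × ℝ → ℝ} (hg : Continuous g) {c : ℝ} (hc : 0 < c)
    (a b : ℝ) (h : ∀ p, g p ≤ -c * (p.1 ^ 2 + p.2 ^ 2) + a * p.1 + b * p.2) :
    Integrable fun p => exp (g p) := by
  refine ((integrable_exp_neg_mul_sq_add_mul hc a).mul_prod
    (integrable_exp_neg_mul_sq_add_mul hc b)).mono' (by fun_prop) ?_
  refine Filter.Eventually.of_forall fun p => ?_
  rw [norm_of_nonneg (exp_pos _).le, ← exp_add, exp_le_exp]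
  linarith [h p]

lemma integrable_exp_neg_mul_cosh {y : ℝ} (hy : 0 < y) (ν : ℝ) :
    Integrable fun u : ℝ => exp (-y * cosh u + ν * u) := by
  refine (integrable_exp_neg_mul_sq_add_mul (half_pos hy) ν).mono' (by fun_prop) ?_
  refine Filter.Eventually.of_forall fun u => ?_
  rw [norm_of_nonneg (exp_pos _).le, exp_le_exp]
  nlinarith [one_add_sq_div_two_le_cosh u]

lemma integrable_sinh_mul_exp_neg_mul_cosh {y : ℝ} (hy : 0 < y) (ν : ℝ) :
    Integrable fun u : ℝ => sinh u * exp (-y * cosh u + ν * u) := by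
  refine (((integrable_exp_neg_mul_cosh hy (ν + 1)).sub
    (integrable_exp_neg_mul_cosh hy (ν - 1))).div_const 2).congr
    (Filter.Eventually.of_forall fun u => ?_)
  have h1 : exp (-y * cosh u + (ν + 1) * u) = exp (-y * cosh u + ν * u) * exp u := by
    rw [← exp_add]; ring_nf
  have h2 : exp (-y * cosh u + (ν - 1) * u) = exp (-y * cosh u + ν * u) * exp (-u) := by
    rw [← exp_add]; ring_nf
  simp only [Pi.sub_apply, h1, h2, sinh_eq]
  ring

/-- Integration by parts in the integral representation of the Macdonald function. -/
lemma integral_sinh_mul_exp_neg_mul_cosh {y : ℝ} (hy : 0 < y) (ν : ℝ) :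
    y * ∫ u : ℝ, sinh u * exp (-y * cosh u + ν * u) =
      ν * ∫ u : ℝ, exp (-y * cosh u + ν * u) := by
  have h1 := (integrable_exp_neg_mul_cosh hy ν).const_mul ν
  have h2 := (integrable_sinh_mul_exp_neg_mul_cosh hy ν).const_mul y
  have h := integral_eq_zero_of_hasDerivAt_of_integrable
    (f := fun u : ℝ => exp (-y * cosh u + ν * u))
    (f' := fun u => ν * exp (-y * cosh u + ν * u) - y * (sinh u * exp (-y * cosh u + ν * u)))
    (fun u => by
      have := ((((hasDerivAt_cosh u).const_mul (-y)).add
        ((hasDerivAt_id u).const_mul ν))).exp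
      convert! this using 1
      simp
      ring)
    (h1.sub h2) (integrable_exp_neg_mul_cosh hy ν)
  rw [integral_sub h1 h2, integral_const_mul, integral_const_mul] at h
  linarith

lemma besselK_eq_integral_exp_neg_mul_cosh (ν : ℝ) {x : ℝ} (hx : 0 < x) :
    besselK ν x = 1 / 2 * ∫ u : ℝ, exp (-x * cosh u + ν * u) := by
  have himage : (fun u : ℝ => x / 2 * exp (-u)) '' univ = Ioi 0 := by
    ext t
    simp only [mem_image, mem_univ, true_and, mem_Ioi]
    constructor
    · rintro ⟨u, rfl⟩
      positivity
    · intro ht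
      refine ⟨-log (t / (x / 2)), ?_⟩
      rw [neg_neg, exp_log (by positivity)]
      field_simp
  have hderiv : ∀ u ∈ (univ : Set ℝ),
      HasDerivWithinAt (fun u : ℝ => x / 2 * exp (-u)) (-(x / 2 * exp (-u))) univ u := by
    intro u _
    have := ((hasDerivAt_neg u).exp.const_mul (x / 2)).hasDerivWithinAt (s := univ)
    convert! this using 1
    ring
  have hinj : InjOn (fun u : ℝ => x / 2 * exp (-u)) univ := by
    intro u _ v _ h
    have h' : exp (-u) = exp (-v) := mul_left_cancel₀ (by positivity) h
    simpa using h'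
  have key := integral_image_eq_integral_abs_deriv_smul MeasurableSet.univ hderiv hinj
    (fun t => exp (-t - x ^ 2 / (4 * t)) * t ^ (-ν - 1))
  rw [himage, setIntegral_univ] at key
  rw [besselK, key, ← integral_const_mul, ← integral_const_mul]
  congr 1
  ext u
  have hpos : 0 < x / 2 * exp (-u) := by positivity
  rw [smul_eq_mul, abs_neg, abs_of_pos hpos, rpow_sub_one hpos.ne',
    mul_rpow (by positivity) (exp_pos _).le, ← exp_mul, div_rpow hx.le (by norm_num),
    rpow_add_one (by norm_num), rpow_neg hx.le, rpow_neg (by norm_num : (0 : ℝ) ≤ 2)]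
  have h1 : -(x / 2 * exp (-u)) - x ^ 2 / (4 * (x / 2 * exp (-u))) = -x * cosh u := by
    rw [cosh_eq, exp_neg]
    field_simp
    ring
  have h2 : -u * -ν = ν * u := by ring
  have : (0 : ℝ) < x ^ ν := by positivity
  rw [h1, h2, exp_add]
  field_simp

lemma besselK_pos (ν : ℝ) {x : ℝ} (hx : 0 < x) : 0 < besselK ν x := by
  rw [besselK_eq_integral_exp_neg_mul_cosh ν hx]
  have := integral_exp_pos (integrable_exp_neg_mul_cosh hx ν)
  positivity

lemma besselK_neg (ν : ℝ) {x : ℝ} (hx : 0 < x) : besselK (-ν) x = besselK ν x := by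
  rw [besselK_eq_integral_exp_neg_mul_cosh _ hx, besselK_eq_integral_exp_neg_mul_cosh _ hx,
    ← integral_neg_eq_self]
  simp [cosh_neg]

lemma integrable_exp_neg_mul_cosh_mul_cosh {x : ℝ} (hx : 0 < x) (a b : ℝ) :
    Integrable fun p : ℝ × ℝ => exp (-(2 * x * cosh p.1) * cosh p.2 + a * p.2 + b * p.1) := by
  refine integrable_exp_of_le_quadratic (by fun_prop) hx b a fun p => ?_
  have h1 := one_add_sq_div_two_le_cosh p.1
  have h2 := one_add_sq_div_two_le_cosh p.2
  have h3 : 1 + p.1 ^ 2 / 2 + p.2 ^ 2 / 2 ≤ cosh p.1 * cosh p.2 := by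
    nlinarith [sq_nonneg p.1, sq_nonneg p.2, mul_nonneg (sq_nonneg p.1) (sq_nonneg p.2)]
  nlinarith

/-- The product formula for Macdonald functions of the same argument, as an iterated integral. -/
lemma besselK_mul_besselK (μ ν : ℝ) {x : ℝ} (hx : 0 < x) :
    besselK μ x * besselK ν x =
      1 / 2 * ∫ t : ℝ, ∫ s : ℝ,
        exp (-(2 * x * cosh t) * cosh s + (μ + ν) * s + (μ - ν) * t) := by
  have hint : Integrable (Function.uncurry fun u t : ℝ =>
      exp (-x * (cosh u + cosh (u - 2 * t)) + μ * u + ν * (u - 2 * t))) := by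
    refine integrable_exp_of_le_quadratic (c := x / 4)
      (g := fun p => -x * (cosh p.1 + cosh (p.1 - 2 * p.2)) + μ * p.1 + ν * (p.1 - 2 * p.2))
      (by fun_prop) (by positivity) (μ + ν) (-2 * ν) fun p => ?_
    have h1 := one_add_sq_div_two_le_cosh p.1
    have h2 := one_add_sq_div_two_le_cosh (p.1 - 2 * p.2)
    have h3 : (p.1 ^ 2 + p.2 ^ 2) / 4 ≤ cosh p.1 + cosh (p.1 - 2 * p.2) := by
      nlinarith [sq_nonneg (3 * p.1 - 4 * p.2), sq_nonneg p.1, sq_nonneg p.2]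
    nlinarith
  have hscale : ∀ u : ℝ, exp (-x * cosh u + μ * u) * ∫ v : ℝ, exp (-x * cosh v + ν * v) =
      2 * ∫ t : ℝ, exp (-x * (cosh u + cosh (u - 2 * t)) + μ * u + ν * (u - 2 * t)) := by
    intro u
    have h1 := integral_sub_left_eq_self (fun v : ℝ => exp (-x * cosh v + ν * v)) volume u
    have h2 := Measure.integral_comp_mul_left
      (fun w : ℝ => exp (-x * cosh (u - w) + ν * (u - w))) 2
    have h3 : ∀ t : ℝ, exp (-x * (cosh u + cosh (u - 2 * t)) + μ * u + ν * (u - 2 * t)) =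
        exp (-x * cosh u + μ * u) * exp (-x * cosh (u - 2 * t) + ν * (u - 2 * t)) := by
      intro t
      rw [← exp_add]
      ring_nf
    simp only [h3, integral_const_mul, h2, h1]
    simp
    ring
  have hshift : ∀ t : ℝ,
      ∫ u : ℝ, exp (-x * (cosh u + cosh (u - 2 * t)) + μ * u + ν * (u - 2 * t)) =
        ∫ s : ℝ, exp (-(2 * x * cosh t) * cosh s + (μ + ν) * s + (μ - ν) * t) := by
    intro t
    rw [← integral_add_right_eq_self _ t]
    congr 1
    ext s
    congr 1
    have : s + t - 2 * t = s - t := by ring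
    rw [this, cosh_add, cosh_sub]
    ring
  rw [besselK_eq_integral_exp_neg_mul_cosh _ hx, besselK_eq_integral_exp_neg_mul_cosh _ hx]
  calc _ = 1 / 4 * ∫ u : ℝ, exp (-x * cosh u + μ * u) * ∫ v : ℝ, exp (-x * cosh v + ν * v) := by
        rw [integral_mul_const]; ring
    _ = 1 / 2 * ∫ u : ℝ, ∫ t : ℝ,
          exp (-x * (cosh u + cosh (u - 2 * t)) + μ * u + ν * (u - 2 * t)) := by
        simp only [hscale, integral_const_mul]; ring
    _ = _ := by
        rw [integral_integral_swap hint]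
        simp only [hshift]

lemma besselK_mul_besselK_eq_integral_prod (μ ν : ℝ) {x : ℝ} (hx : 0 < x) :
    besselK μ x * besselK ν x =
      1 / 2 * ∫ p : ℝ × ℝ,
        exp (-(2 * x * cosh p.1) * cosh p.2 + (μ + ν) * p.2 + (μ - ν) * p.1) := by
  rw [besselK_mul_besselK μ ν hx, Measure.volume_eq_prod,
    integral_prod _ (integrable_exp_neg_mul_cosh_mul_cosh hx _ _)]

lemma sinh_fst_mul_exp_eq (x a b : ℝ) (p : ℝ × ℝ) :
    sinh p.1 * exp (-(2 * x * cosh p.1) * cosh p.2 + a * p.2 + b * p.1) =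
      (exp (-(2 * x * cosh p.1) * cosh p.2 + a * p.2 + (b + 1) * p.1) -
        exp (-(2 * x * cosh p.1) * cosh p.2 + a * p.2 + (b - 1) * p.1)) / 2 := by
  simp only [sinh_eq, sub_mul, add_mul, exp_add, exp_sub, exp_neg, one_mul]
  field_simp

lemma integrable_sinh_fst_mul_exp {x : ℝ} (hx : 0 < x) (a b : ℝ) :
    Integrable fun p : ℝ × ℝ =>
      sinh p.1 * exp (-(2 * x * cosh p.1) * cosh p.2 + a * p.2 + b * p.1) := by
  simp only [sinh_fst_mul_exp_eq]
  exact ((integrable_exp_neg_mul_cosh_mul_cosh hx _ _).sub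
    (integrable_exp_neg_mul_cosh_mul_cosh hx _ _)).div_const 2

lemma exp_add_one_mul_snd (x a b : ℝ) (p : ℝ × ℝ) :
    exp (-(2 * x * cosh p.1) * cosh p.2 + (a + 1) * p.2 + b * p.1) =
      exp p.2 * exp (-(2 * x * cosh p.1) * cosh p.2 + a * p.2 + b * p.1) := by
  rw [← exp_add]
  ring_nf

lemma exp_sub_one_mul_snd (x a b : ℝ) (p : ℝ × ℝ) :
    exp (-(2 * x * cosh p.1) * cosh p.2 + (a - 1) * p.2 + b * p.1) =
      exp (-p.2) * exp (-(2 * x * cosh p.1) * cosh p.2 + a * p.2 + b * p.1) := by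
  rw [← exp_add]
  ring_nf

lemma integrable_sinh_fst_mul_sinh_snd_mul_exp {x : ℝ} (hx : 0 < x) (a b : ℝ) :
    Integrable fun p : ℝ × ℝ =>
      2 * x * sinh p.1 * sinh p.2 *
        exp (-(2 * x * cosh p.1) * cosh p.2 + a * p.2 + b * p.1) := by
  refine (((integrable_sinh_fst_mul_exp hx (a + 1) b).sub
    (integrable_sinh_fst_mul_exp hx (a - 1) b)).const_mul x).congr
    (Filter.Eventually.of_forall fun p => ?_)
  simp only [Pi.sub_apply, exp_add_one_mul_snd, exp_sub_one_mul_snd, sinh_eq p.2]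
  ring

lemma integrable_sinh_fst_mul_cosh_snd_mul_exp {x : ℝ} (hx : 0 < x) (a b : ℝ) :
    Integrable fun p : ℝ × ℝ =>
      2 * x * sinh p.1 * cosh p.2 *
        exp (-(2 * x * cosh p.1) * cosh p.2 + a * p.2 + b * p.1) := by
  refine (((integrable_sinh_fst_mul_exp hx (a + 1) b).add
    (integrable_sinh_fst_mul_exp hx (a - 1) b)).const_mul x).congr
    (Filter.Eventually.of_forall fun p => ?_)
  simp only [Pi.add_apply, exp_add_one_mul_snd, exp_sub_one_mul_snd, cosh_eq p.2]
  ring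

/-- Integration by parts in the first variable. -/
lemma mul_integral_exp_eq_integral_sinh_fst_mul_cosh_snd {x : ℝ} (hx : 0 < x) (a b : ℝ) :
    b * ∫ p : ℝ × ℝ, exp (-(2 * x * cosh p.1) * cosh p.2 + a * p.2 + b * p.1) =
      ∫ p : ℝ × ℝ, 2 * x * sinh p.1 * cosh p.2 *
        exp (-(2 * x * cosh p.1) * cosh p.2 + a * p.2 + b * p.1) := by
  rw [Measure.volume_eq_prod, integral_prod_symm _ (integrable_exp_neg_mul_cosh_mul_cosh hx a b),
    integral_prod_symm _ (integrable_sinh_fst_mul_cosh_snd_mul_exp hx a b),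
    ← integral_const_mul]
  congr 1
  ext s
  have h := integral_sinh_mul_exp_neg_mul_cosh
    (mul_pos (mul_pos two_pos hx) (cosh_pos s)) b
  have h1 : ∀ t, exp (-(2 * x * cosh t) * cosh s + a * s + b * t) =
      exp (a * s) * exp (-(2 * x * cosh s) * cosh t + b * t) := fun t => by
    rw [← exp_add]
    ring_nf
  have h2 : ∀ t, 2 * x * sinh t * cosh s * exp (-(2 * x * cosh t) * cosh s + a * s + b * t) =
      exp (a * s) * (2 * x * cosh s) *
        (sinh t * exp (-(2 * x * cosh s) * cosh t + b * t)) := fun t => by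
    rw [h1]
    ring
  simp only [h2]
  simp only [h1, integral_const_mul]
  rw [mul_assoc (exp (a * s)), h]
  ring

/-- Integration by parts in the second variable. -/
lemma integral_sinh_mul_sinh_mul_exp {x : ℝ} (hx : 0 < x) (a b t : ℝ) :
    ∫ s : ℝ, 2 * x * sinh t * sinh s * exp (-(2 * x * cosh t) * cosh s + a * s + b * t) =
      2 * a * (besselK a (2 * x * cosh t) * exp (b * t) * tanh t) := by
  have hc := cosh_pos t
  have hy : 0 < 2 * x * cosh t := by positivity
  have h := integral_sinh_mul_exp_neg_mul_cosh hy a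
  have h2 : ∀ s, 2 * x * sinh t * sinh s * exp (-(2 * x * cosh t) * cosh s + a * s + b * t) =
      exp (b * t) * tanh t * (2 * x * cosh t) *
        (sinh s * exp (-(2 * x * cosh t) * cosh s + a * s)) := fun s => by
    rw [exp_add _ (b * t), tanh_eq_sinh_div_cosh]
    field_simp
  simp only [h2, integral_const_mul]
  rw [mul_assoc (exp (b * t) * tanh t), h, besselK_eq_integral_exp_neg_mul_cosh _ hy]
  ring

lemma integral_eq_integral_Ioi_add_neg {f : ℝ → ℝ} (hf : Integrable f) :
    ∫ t, f t = ∫ t in Ioi 0, (f t + f (-t)) := by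
  rw [integral_add hf.integrableOn hf.comp_neg.integrableOn, integral_comp_neg_Ioi, neg_zero,
    add_comm]
  exact (intervalIntegral.integral_Iic_add_Ioi hf.integrableOn hf.integrableOn).symm

/-- The difference formula with denominators cleared. -/
lemma besselK_mul_difference (α ε : ℝ) {x : ℝ} (hx : 0 < x) :
    ε * (besselK (α + ε) x * besselK α x) +
        x * (besselK (α + ε - 1) x * besselK α x - besselK (α + ε) x * besselK (α - 1) x) =
      2 * (2 * α + ε) * ∫ t in Ioi (0 : ℝ),
        besselK (2 * α + ε) (2 * x * cosh t) * sinh (ε * t) * tanh t := by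
  set n := 2 * α + ε with hn
  have hC := integrable_sinh_fst_mul_cosh_snd_mul_exp hx n ε
  have hD := integrable_sinh_fst_mul_sinh_snd_mul_exp hx n ε
  have hB := (integrable_sinh_fst_mul_exp hx (n - 1) ε).const_mul (2 * x)
  have hdiff : besselK (α + ε - 1) x * besselK α x - besselK (α + ε) x * besselK (α - 1) x =
      -∫ p : ℝ × ℝ, sinh p.1 *
        exp (-(2 * x * cosh p.1) * cosh p.2 + (n - 1) * p.2 + ε * p.1) := by
    rw [besselK_mul_besselK_eq_integral_prod _ _ hx, besselK_mul_besselK_eq_integral_prod _ _ hx]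
    have e1 : α + ε - 1 + α = n - 1 := by rw [hn]; ring
    have e2 : α + ε - 1 - α = ε - 1 := by ring
    have e3 : α + ε + (α - 1) = n - 1 := by rw [hn]; ring
    have e4 : α + ε - (α - 1) = ε + 1 := by ring
    simp only [e1, e2, e3, e4, sinh_fst_mul_exp_eq]
    rw [integral_div, integral_sub (integrable_exp_neg_mul_cosh_mul_cosh hx _ _)
      (integrable_exp_neg_mul_cosh_mul_cosh hx _ _)]
    ring
  have hprod : ε * (besselK (α + ε) x * besselK α x) =
      1 / 2 * ∫ p : ℝ × ℝ, 2 * x * sinh p.1 * cosh p.2 *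
        exp (-(2 * x * cosh p.1) * cosh p.2 + n * p.2 + ε * p.1) := by
    rw [← mul_integral_exp_eq_integral_sinh_fst_mul_cosh_snd hx,
      besselK_mul_besselK_eq_integral_prod _ _ hx]
    have e1 : α + ε + α = n := by rw [hn]; ring
    have e2 : α + ε - α = ε := by ring
    simp only [e1, e2]
    ring
  have hcombine : (∫ p : ℝ × ℝ, 2 * x * sinh p.1 * cosh p.2 *
        exp (-(2 * x * cosh p.1) * cosh p.2 + n * p.2 + ε * p.1)) -
      2 * x * (∫ p : ℝ × ℝ, sinh p.1 *
        exp (-(2 * x * cosh p.1) * cosh p.2 + (n - 1) * p.2 + ε * p.1)) =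
      ∫ p : ℝ × ℝ, 2 * x * sinh p.1 * sinh p.2 *
        exp (-(2 * x * cosh p.1) * cosh p.2 + n * p.2 + ε * p.1) := by
    rw [← integral_const_mul, ← integral_sub hC hB]
    congr 1
    ext p
    rw [exp_sub_one_mul_snd, ← cosh_sub_sinh]
    ring
  have hT : Integrable fun t : ℝ =>
      2 * n * (besselK n (2 * x * cosh t) * exp (ε * t) * tanh t) := by
    have := hD.integral_prod_left
    simpa only [integral_sinh_mul_sinh_mul_exp hx] using this
  have hfold : (∫ p : ℝ × ℝ, 2 * x * sinh p.1 * sinh p.2 *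
        exp (-(2 * x * cosh p.1) * cosh p.2 + n * p.2 + ε * p.1)) =
      4 * n * ∫ t in Ioi (0 : ℝ), besselK n (2 * x * cosh t) * sinh (ε * t) * tanh t := by
    rw [Measure.volume_eq_prod, integral_prod _ hD]
    simp only [integral_sinh_mul_sinh_mul_exp hx]
    rw [integral_eq_integral_Ioi_add_neg hT, ← integral_const_mul]
    congr 1
    ext t
    rw [cosh_neg, tanh_neg, mul_neg ε t, sinh_eq (ε * t)]
    ring
  rw [hdiff, hprod]
  linear_combination 1 / 2 * hcombine + 1 / 2 * hfold

/-- For every `α ≥ 0`, `ε > 0` and `x > 0`,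
`R_{α+ε}(x) − R_α(x)
  = 2(2α+ε) ∫_0^∞ K_{2α+ε}(2x cosh t)/(K_{α+ε}(x) K_α(x)) · sinh(εt) tanh(t) dt`. -/
theorem besselR_difference_formula (α ε x : ℝ) (hα : 0 ≤ α) (hε : 0 < ε) (hx : 0 < x) :
    besselR (α + ε) x - besselR α x =
      2 * (2 * α + ε) *
        ∫ t in Set.Ioi (0 : ℝ),
          besselK (2 * α + ε) (2 * x * Real.cosh t) / (besselK (α + ε) x * besselK α x) *
            Real.sinh (ε * t) * Real.tanh t := by
  have hK := (besselK_pos α hx).ne'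
  have hK' := (besselK_pos (α + ε) hx).ne'
  have hint : ∀ t : ℝ,
      besselK (2 * α + ε) (2 * x * cosh t) / (besselK (α + ε) x * besselK α x) *
          sinh (ε * t) * tanh t =
        besselK (2 * α + ε) (2 * x * cosh t) * sinh (ε * t) * tanh t /
          (besselK (α + ε) x * besselK α x) := fun t => by ring
  have hsymm : besselK (1 - α) x = besselK (α - 1) x := by
    rw [← besselK_neg _ hx, neg_sub]
  have hsymm' : besselK (1 - (α + ε)) x = besselK (α + ε - 1) x := by
    rw [← besselK_neg _ hx, neg_sub]
  simp only [hint]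
  rw [integral_div, ← mul_div_assoc, ← besselK_mul_difference α ε hx, besselR, besselR,
    if_neg hx.ne', if_neg hx.ne', hsymm, hsymm']
  field_simp
  ring
end

section
/- For every fixed α ≥ 0, the map x ↦ R_α(x) is strictly increasing on [0, ∞) and tends to infinity as x → ∞; in particular, for all x > 0 the derivative (d/dx)( x·K_{1−α}(x)/K_α(x) ) is strictly positive. -/
open MeasureTheory Set Filter Topology

/-- The weighted Gamma-type integral `∫_0^∞ exp(−t − y/t) t^s dt`. -/
noncomputable def gammaTwist (s y : ℝ) : ℝ :=
  ∫ t in Ioi (0 : ℝ), Real.exp (-t - y / t) * t ^ s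

theorem continuousOn_gammaTwist_integrand (s y : ℝ) :
    ContinuousOn (fun t : ℝ => Real.exp (-t - y / t) * t ^ s) (Ioi 0) := by
  refine ContinuousOn.mul (ContinuousOn.rexp ?_) ?_
  · exact continuousOn_id.neg.sub (continuousOn_const.div continuousOn_id fun t ht => ne_of_gt ht)
  · exact continuousOn_id.rpow_const fun t ht => Or.inl (ne_of_gt ht)

theorem exp_neg_div_le {y t : ℝ} (hy : 0 < y) (ht : 0 < t) (n : ℕ) :
    Real.exp (-(y / t)) ≤ n.factorial / y ^ n * t ^ n := by
  have h := Real.pow_div_factorial_le_exp _ (div_pos hy ht).le n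
  rw [Real.exp_neg]
  calc (Real.exp (y / t))⁻¹ ≤ ((y / t) ^ n / n.factorial)⁻¹ := inv_anti₀ (by positivity) h
    _ = _ := by rw [div_pow]; field_simp

theorem integrableOn_gammaTwist (s : ℝ) {y : ℝ} (hy : 0 < y) :
    IntegrableOn (fun t : ℝ => Real.exp (-t - y / t) * t ^ s) (Ioi 0) := by
  obtain ⟨n, hn⟩ := exists_nat_gt (-s - 1)
  have hG := (Real.GammaIntegral_convergent (s := s + n + 1) (by linarith)).const_mul
    (n.factorial / y ^ n)
  refine Integrable.mono' hG
    ((continuousOn_gammaTwist_integrand s y).aestronglyMeasurable measurableSet_Ioi) ?_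
  filter_upwards [ae_restrict_mem measurableSet_Ioi] with t ht
  have ht : 0 < t := ht
  rw [Real.norm_of_nonneg (by positivity), sub_eq_add_neg, Real.exp_add]
  calc Real.exp (-t) * Real.exp (-(y / t)) * t ^ s
      ≤ Real.exp (-t) * (n.factorial / y ^ n * t ^ n) * t ^ s := by
        gcongr; exact exp_neg_div_le hy ht n
    _ = _ := by
        rw [show s + n + 1 - 1 = s + n by ring, Real.rpow_add ht, Real.rpow_natCast]; ring

theorem gammaTwist_pos (s : ℝ) {y : ℝ} (hy : 0 < y) : 0 < gammaTwist s y := by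
  refine (setIntegral_pos_iff_support_of_nonneg_ae ?_ (integrableOn_gammaTwist s hy)).2 ?_
  · filter_upwards [ae_restrict_mem measurableSet_Ioi] with t ht
    have ht : 0 < t := ht
    positivity
  · refine lt_of_lt_of_le (b := volume (Ioi (0 : ℝ))) (by simp) (measure_mono fun t ht => ⟨?_, ht⟩)
    have ht : 0 < t := ht
    simp only [Function.mem_support]
    positivity

theorem hasDerivAt_gammaTwist (s : ℝ) {y : ℝ} (hy : 0 < y) :
    HasDerivAt (gammaTwist s) (-gammaTwist (s - 1) y) y := by
  have h := (hasDerivAt_integral_of_dominated_loc_of_deriv_le (μ := volume.restrict (Ioi (0 : ℝ)))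
    (F := fun z t => Real.exp (-t - z / t) * t ^ s)
    (F' := fun z t => -(Real.exp (-t - z / t) * t ^ (s - 1)))
    (bound := fun t => Real.exp (-t - (y / 2) / t) * t ^ (s - 1))
    (Ioi_mem_nhds (half_lt_self hy))
    (Eventually.of_forall fun z =>
      (continuousOn_gammaTwist_integrand s z).aestronglyMeasurable measurableSet_Ioi)
    (integrableOn_gammaTwist s hy)
    ((continuousOn_gammaTwist_integrand (s - 1) y).neg.aestronglyMeasurable measurableSet_Ioi)
    ?_ (integrableOn_gammaTwist (s - 1) (half_pos hy)) ?_).2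
  · rwa [integral_neg] at h
  · filter_upwards [ae_restrict_mem measurableSet_Ioi] with t ht z hz
    have ht : 0 < t := ht
    have hz : y / 2 < z := hz
    rw [norm_neg, Real.norm_of_nonneg (by positivity)]
    gcongr
  · filter_upwards [ae_restrict_mem measurableSet_Ioi] with t ht z hz
    have ht : 0 < t := ht
    convert! ((((hasDerivAt_id z).div_const t).const_sub (-t)).exp.mul_const (t ^ s)) using 1
    rw [Real.rpow_sub_one ht.ne']
    simp only [id]
    ring

/-- Strict log-convexity of `gammaTwist` in the exponent, at unit spacing. -/
theorem gammaTwist_sq_lt (s : ℝ) {y : ℝ} (hy : 0 < y) :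
    gammaTwist s y ^ 2 < gammaTwist (s + 1) y * gammaTwist (s - 1) y := by
  set c := gammaTwist s y / gammaTwist (s - 1) y
  have hpos := gammaTwist_pos (s - 1) hy
  have hi1 := integrableOn_gammaTwist (s + 1) hy
  have hi0 := (integrableOn_gammaTwist s hy).const_mul (2 * c)
  have hi2 := (integrableOn_gammaTwist (s - 1) hy).const_mul (c ^ 2)
  have hi10 : IntegrableOn (fun t => Real.exp (-t - y / t) * t ^ (s + 1)
      - 2 * c * (Real.exp (-t - y / t) * t ^ s)) (Ioi 0) := hi1.sub hi0
  have hi : IntegrableOn (fun t => Real.exp (-t - y / t) * t ^ (s + 1)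
      - 2 * c * (Real.exp (-t - y / t) * t ^ s)
      + c ^ 2 * (Real.exp (-t - y / t) * t ^ (s - 1))) (Ioi 0) := hi10.add hi2
  have heq : ∀ t ∈ Ioi (0 : ℝ), Real.exp (-t - y / t) * t ^ (s + 1)
      - 2 * c * (Real.exp (-t - y / t) * t ^ s) + c ^ 2 * (Real.exp (-t - y / t) * t ^ (s - 1))
      = (t - c) ^ 2 * (Real.exp (-t - y / t) * t ^ (s - 1)) := by
    intro t ht
    have ht : 0 < t := ht
    rw [Real.rpow_add_one ht.ne', Real.rpow_sub_one ht.ne']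
    field_simp
    ring
  have hlt : 0 < ∫ t in Ioi (0 : ℝ), (Real.exp (-t - y / t) * t ^ (s + 1)
      - 2 * c * (Real.exp (-t - y / t) * t ^ s)
      + c ^ 2 * (Real.exp (-t - y / t) * t ^ (s - 1))) := by
    refine (setIntegral_pos_iff_support_of_nonneg_ae ?_ hi).2 ?_
    · filter_upwards [ae_restrict_mem measurableSet_Ioi] with t ht
      rw [heq t ht]
      have ht : 0 < t := ht
      positivity
    · refine lt_of_lt_of_le (b := volume (Ioi (max 0 c))) (by simp)
        (measure_mono fun t ht => ?_)
      obtain ⟨ht, htc⟩ := max_lt_iff.1 (mem_Ioi.1 ht)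
      refine ⟨?_, ht⟩
      rw [Function.mem_support, heq t ht]
      have := sub_pos.2 htc
      positivity
  rw [integral_add hi10 hi2, integral_sub hi1 hi0, integral_const_mul,
    integral_const_mul] at hlt
  change 0 < gammaTwist (s + 1) y - 2 * c * gammaTwist s y + c ^ 2 * gammaTwist (s - 1) y at hlt
  have := mul_pos hlt hpos
  have hcm : c * gammaTwist (s - 1) y = gammaTwist s y := div_mul_cancel₀ _ hpos.ne'
  rw [← hcm] at this ⊢
  nlinarith

theorem tendsto_gammaTwist_integrand_atTop (s : ℝ) {y : ℝ} (hy : 0 < y) :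
    Tendsto (fun t : ℝ => Real.exp (-t - y / t) * t ^ s) atTop (𝓝 0) := by
  refine squeeze_zero' (g := fun t : ℝ => t ^ s * Real.exp (-1 * t)) ?_ ?_
    (tendsto_rpow_mul_exp_neg_mul_atTop_nhds_zero s 1 one_pos)
  · filter_upwards [eventually_gt_atTop 0] with t ht
    positivity
  · filter_upwards [eventually_gt_atTop 0] with t ht
    rw [mul_comm]
    gcongr
    have := div_pos hy ht
    linarith

theorem tendsto_gammaTwist_integrand_zero (s : ℝ) {y : ℝ} (hy : 0 < y) :
    Tendsto (fun t : ℝ => Real.exp (-t - y / t) * t ^ s) (𝓝[>] 0) (𝓝 0) := by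
  refine squeeze_zero' (g := fun t : ℝ => t⁻¹ ^ (-s) * Real.exp (-y * t⁻¹)) ?_ ?_
    ((tendsto_rpow_mul_exp_neg_mul_atTop_nhds_zero (-s) y hy).comp tendsto_inv_nhdsGT_zero)
  · filter_upwards [self_mem_nhdsWithin] with t ht
    have ht : 0 < t := ht
    positivity
  · filter_upwards [self_mem_nhdsWithin] with t ht
    have ht : 0 < t := ht
    rw [mul_comm, Real.inv_rpow ht.le, Real.rpow_neg ht.le, inv_inv]
    gcongr
    rw [div_eq_mul_inv]
    linarith

/-- The three-term recurrence, by integration by parts. -/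
theorem gammaTwist_add_one (s : ℝ) {y : ℝ} (hy : 0 < y) :
    gammaTwist (s + 1) y = y * gammaTwist (s - 1) y + (s + 1) * gammaTwist s y := by
  have hi1 := integrableOn_gammaTwist (s + 1) hy
  have hi0 := (integrableOn_gammaTwist s hy).const_mul (s + 1)
  have hi2 := (integrableOn_gammaTwist (s - 1) hy).const_mul y
  have hi20 : IntegrableOn (fun t => y * (Real.exp (-t - y / t) * t ^ (s - 1))
      + (s + 1) * (Real.exp (-t - y / t) * t ^ s)) (Ioi 0) := hi2.add hi0
  have hi : IntegrableOn (fun t => y * (Real.exp (-t - y / t) * t ^ (s - 1))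
      + (s + 1) * (Real.exp (-t - y / t) * t ^ s)
      - Real.exp (-t - y / t) * t ^ (s + 1)) (Ioi 0) := hi20.sub hi1
  have heq : ∀ t ∈ Ioi (0 : ℝ), Real.exp (-t - y / t) * (-1 + y / t ^ 2) * t ^ (s + 1)
      + Real.exp (-t - y / t) * ((s + 1) * t ^ s)
      = y * (Real.exp (-t - y / t) * t ^ (s - 1)) + (s + 1) * (Real.exp (-t - y / t) * t ^ s)
        - Real.exp (-t - y / t) * t ^ (s + 1) := by
    intro t ht
    have ht : 0 < t := ht
    rw [Real.rpow_add_one ht.ne', Real.rpow_sub_one ht.ne']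
    field_simp
    ring
  have h := integral_Ioi_deriv_mul_eq_sub (a := 0) (a' := (0 : ℝ)) (b' := 0)
    (u := fun t : ℝ => Real.exp (-t - y / t)) (v := fun t : ℝ => t ^ (s + 1))
    (u' := fun t => Real.exp (-t - y / t) * (-1 + y / t ^ 2)) (v' := fun t => (s + 1) * t ^ s)
    (fun t ht => ?_) (fun t ht => ?_)
    (hi.congr_fun (fun t ht => (heq t ht).symm) measurableSet_Ioi)
    (tendsto_gammaTwist_integrand_zero (s + 1) hy)
    (tendsto_gammaTwist_integrand_atTop (s + 1) hy)
  · rw [setIntegral_congr_fun measurableSet_Ioi heq, integral_sub hi20 hi1,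
      integral_add hi2 hi0, integral_const_mul, integral_const_mul] at h
    change y * gammaTwist (s - 1) y + (s + 1) * gammaTwist s y - gammaTwist (s + 1) y = 0 - 0 at h
    linarith
  · have ht : t ≠ 0 := ne_of_gt ht
    have hd : HasDerivAt (fun t : ℝ => -t - y / t) (-1 + y / t ^ 2) t := by
      convert! (hasDerivAt_id t).neg.sub ((hasDerivAt_inv ht).const_mul y) using 1
      ring
    exact hd.exp
  · simpa using Real.hasDerivAt_rpow_const (p := s + 1) (Or.inl (ne_of_gt ht))

/-- The reflection `t ↦ y / t`. -/
theorem gammaTwist_reflect (s : ℝ) {y : ℝ} (hy : 0 < y) :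
    gammaTwist s y = y ^ (s + 1) * gammaTwist (-s - 2) y := by
  have h1 := integral_comp_rpow_Ioi (fun t : ℝ => Real.exp (-t - y / t) * t ^ s)
    (p := -1) (by norm_num)
  have h2 := integral_comp_mul_left_Ioi'
    (fun t : ℝ => (|(-1 : ℝ)| * t ^ ((-1 : ℝ) - 1)) •
      (Real.exp (-(t ^ (-1 : ℝ)) - y / t ^ (-1 : ℝ)) * (t ^ (-1 : ℝ)) ^ s)) 0 (inv_pos.2 hy)
  rw [mul_zero] at h2
  rw [gammaTwist, ← h1, ← h2, gammaTwist, smul_eq_mul, ← integral_const_mul, ← integral_const_mul]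
  refine setIntegral_congr_fun measurableSet_Ioi fun t ht => ?_
  have ht : 0 < t := ht
  have hu : (y⁻¹ * t) ^ (-1 : ℝ) = y / t := by
    rw [Real.rpow_neg_one, mul_inv, inv_inv, div_eq_mul_inv]
  have hv : (y⁻¹ * t) ^ ((-1 : ℝ) - 1) = (y / t) ^ 2 := by
    rw [Real.rpow_sub_one (by positivity), hu]
    field_simp
  have he : y / (y / t) = t := by field_simp
  simp only [hu, hv, he, smul_eq_mul, abs_neg, abs_one, one_mul]
  rw [Real.div_rpow hy.le ht.le, Real.rpow_add_one hy.ne', Real.rpow_sub ht, Real.rpow_neg ht.le,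
    Real.rpow_ofNat, show -(y / t) - t = -t - y / t by ring]
  field_simp

theorem besselK_eq (ν x : ℝ) :
    besselK ν x = x ^ ν / 2 ^ (ν + 1) * gammaTwist (-ν - 1) (x ^ 2 / 4) := by
  simp only [besselK, gammaTwist, div_div]

theorem mul_besselK_div_besselK (α : ℝ) {x : ℝ} (hx : 0 < x) :
    x * besselK (1 - α) x / besselK α x =
      2 * (gammaTwist (-α) (x ^ 2 / 4) / gammaTwist (-α - 1) (x ^ 2 / 4)) := by
  have hy : 0 < x ^ 2 / 4 := by positivity
  have hpos := gammaTwist_pos (-α - 1) hy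
  rw [besselK_eq, besselK_eq, gammaTwist_reflect (-(1 - α) - 1) hy,
    show -(-(1 - α) - 1) - 2 = -α by ring, show -(1 - α) - 1 + 1 = α - 1 by ring]
  have h4 : (x ^ 2 / 4) ^ (α - 1) = (x ^ (α - 1) / 2 ^ (α - 1)) ^ 2 := by
    rw [show x ^ 2 / 4 = (x / 2) ^ 2 by ring, ← Real.div_rpow hx.le (by norm_num),
      ← Real.rpow_natCast, ← Real.rpow_natCast, ← Real.rpow_mul (by positivity),
      ← Real.rpow_mul (by positivity), mul_comm]
  rw [h4, show 1 - α = -(α - 1) by ring, Real.rpow_neg hx.le,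
    show -(α - 1) + 1 = 1 - (α - 1) by ring, Real.rpow_sub two_pos (1 : ℝ) (α - 1),
    Real.rpow_sub_one hx.ne', Real.rpow_sub_one two_ne_zero, Real.rpow_add_one two_ne_zero,
    Real.rpow_one]
  have := Real.rpow_pos_of_pos hx α
  have := Real.rpow_pos_of_pos two_pos α
  field_simp

theorem hasDerivAt_gammaTwist_ratio (s : ℝ) {y : ℝ} (hy : 0 < y) :
    ∃ d > 0, HasDerivAt (fun y => gammaTwist (s + 1) y / gammaTwist s y) d y := by
  have hpos := gammaTwist_pos s hy
  refine ⟨_, ?_, (hasDerivAt_gammaTwist (s + 1) hy).div (hasDerivAt_gammaTwist s hy) hpos.ne'⟩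
  have := gammaTwist_sq_lt s hy
  rw [add_sub_cancel_right]
  refine div_pos ?_ (by positivity)
  nlinarith

/-- `x K_{1−α}(x) / K_α(x)` has a strictly positive derivative on `(0, ∞)`. -/
theorem deriv_mul_besselK_div_besselK_pos (α : ℝ) {x : ℝ} (hx : 0 < x) :
    0 < deriv (fun y : ℝ => y * besselK (1 - α) y / besselK α y) x := by
  obtain ⟨d, hd, h⟩ := hasDerivAt_gammaTwist_ratio (-α - 1) (y := x ^ 2 / 4) (by positivity)
  rw [sub_add_cancel] at h
  have h2 := (h.comp x (((hasDerivAt_id x).pow 2).div_const 4)).const_mul 2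
  have heq : (fun y : ℝ => y * besselK (1 - α) y / besselK α y) =ᶠ[𝓝 x] fun y =>
      2 * (gammaTwist (-α) (y ^ 2 / 4) / gammaTwist (-α - 1) (y ^ 2 / 4)) := by
    filter_upwards [Ioi_mem_nhds hx] with y hy using mul_besselK_div_besselK α hy
  refine lt_of_lt_of_eq ?_ (h2.congr_of_eventuallyEq heq).deriv.symm
  simp only [id]
  positivity

/-- The ratio `r` of consecutive `gammaTwist`s satisfies `y < r (r + α)`. -/
theorem lt_gammaTwist_ratio_mul (α : ℝ) {y : ℝ} (hy : 0 < y) :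
    y < gammaTwist (-α) y / gammaTwist (-α - 1) y *
      (gammaTwist (-α) y / gammaTwist (-α - 1) y + α) := by
  have hpos := gammaTwist_pos (-α - 1) hy
  have h1 := gammaTwist_sq_lt (-α - 1) hy
  have h2 := gammaTwist_add_one (-α - 1) hy
  have h0 := gammaTwist_pos (-α) hy
  rw [sub_add_cancel] at h1 h2
  have h3 : gammaTwist (-α) y / gammaTwist (-α - 1) y + α =
      y * gammaTwist (-α - 1 - 1) y / gammaTwist (-α - 1) y := by
    field_simp
    linarith
  rw [h3, div_mul_div_comm, lt_div_iff₀ (by positivity)]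
  nlinarith

theorem tendsto_besselR_atTop (α : ℝ) (hα : 0 ≤ α) :
    Tendsto (fun x => besselR α x) atTop atTop := by
  rw [tendsto_atTop]
  intro b
  set M := max b 0
  filter_upwards [eventually_gt_atTop (M + α)] with x hx
  have hM : 0 ≤ M := le_max_right _ _
  have hx0 : 0 < x := by linarith
  have hy : 0 < x ^ 2 / 4 := by positivity
  rw [besselR, if_neg hx0.ne', mul_besselK_div_besselK α hx0]
  have hr := lt_gammaTwist_ratio_mul α hy
  have hr0 := div_pos (gammaTwist_pos (-α) hy) (gammaTwist_pos (-α - 1) hy)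
  set r := gammaTwist (-α) (x ^ 2 / 4) / gammaTwist (-α - 1) (x ^ 2 / 4)
  refine (le_max_left b 0).trans ?_
  by_contra! hlt
  change α + 2 * r < M at hlt
  nlinarith

theorem strictMonoOn_besselR (α : ℝ) : StrictMonoOn (fun x => besselR α x) (Ici 0) := by
  intro a ha b hb hab
  have ha : 0 ≤ a := ha
  have hb0 : 0 < b := ha.trans_lt hab
  rcases ha.eq_or_lt with rfl | ha0
  · have hy : 0 < b ^ 2 / 4 := by positivity
    have := div_pos (gammaTwist_pos (-α) hy) (gammaTwist_pos (-α - 1) hy)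
    simp only [besselR, if_true, if_neg hb0.ne', mul_besselK_div_besselK α hb0]
    linarith
  · simp only [besselR, if_neg hb0.ne', if_neg ha0.ne']
    have hd := fun x (hx : x ∈ Ioi (0 : ℝ)) => deriv_mul_besselK_div_besselK_pos α hx
    have hmono := strictMonoOn_of_deriv_pos (convex_Ioi (0 : ℝ))
      (fun x hx => (differentiableAt_of_deriv_ne_zero
        (hd x hx).ne').continuousAt.continuousWithinAt)
      (by simpa using hd)
    have := hmono ha0 hb0 hab
    linarith

/-- For every fixed `α ≥ 0`, the map `x ↦ R_α(x)` is strictly increasing on `[0, ∞)`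
and tends to infinity as `x → ∞`; in particular, for all `x > 0` the derivative
`(d/dx)(x·K_{1−α}(x)/K_α(x))` is strictly positive. -/
theorem besselR_strictMono_in_argument (α : ℝ) (hα : 0 ≤ α) :
    StrictMonoOn (fun x => besselR α x) (Set.Ici 0) ∧
    Filter.Tendsto (fun x => besselR α x) Filter.atTop Filter.atTop ∧
    ∀ x : ℝ, 0 < x →
      0 < deriv (fun y : ℝ => y * besselK (1 - α) y / besselK α y) x :=
  ⟨strictMonoOn_besselR α, tendsto_besselR_atTop α hα,
    fun _ hx => deriv_mul_besselK_div_besselK_pos α hx⟩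
end

section
/- For every α ∈ [0, 1/2) and every x ≥ 0, 1 − α − x·K_{1−α}(x)/K_α(x) > −x² + 1/4, where the value of x·K_{1−α}(x)/K_α(x) at x = 0 is taken to be 0. -/
open MeasureTheory Set

/-- The two-sided exponential form `∫ exp (-x cosh u + ν u) du` of `2 K_ν(x)`. -/
noncomputable def expCoshIntegral (ν x : ℝ) : ℝ :=
  ∫ u : ℝ, Real.exp (-x * Real.cosh u + ν * u)

lemma sq_div_four_le_cosh (u : ℝ) : u ^ 2 / 4 ≤ Real.cosh u := by
  have h := Real.quadratic_le_exp_of_nonneg (abs_nonneg u)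
  have h' := Real.exp_pos (-|u|)
  have h'' := abs_nonneg u
  rw [sq_abs] at h
  rw [← Real.cosh_abs, Real.cosh_eq]
  linarith

lemma integrable_exp_cosh (ν : ℝ) {x : ℝ} (hx : 0 < x) :
    Integrable fun u : ℝ => Real.exp (-x * Real.cosh u + ν * u) := by
  have hb : ((-(x / 4) : ℝ) : ℂ).re < 0 := by
    rw [Complex.ofReal_re]
    linarith
  refine (integrable_cexp_quadratic' hb (ν : ℂ) 0).mono
    (by fun_prop) (ae_of_all _ fun u => ?_)
  have hre : (((-(x / 4) : ℝ) : ℂ) * (u : ℂ) ^ 2 + (ν : ℂ) * u + 0) =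
      ((-(x / 4) * u ^ 2 + ν * u : ℝ) : ℂ) := by push_cast; ring
  rw [hre, Complex.norm_exp, Complex.ofReal_re, Real.norm_eq_abs, Real.abs_exp]
  apply Real.exp_le_exp.mpr
  nlinarith [mul_le_mul_of_nonneg_left (sq_div_four_le_cosh u) hx.le]

lemma cosh_mul_exp_cosh (ν x u : ℝ) :
    Real.cosh u * Real.exp (-x * Real.cosh u + ν * u) =
      (Real.exp (-x * Real.cosh u + (ν + 1) * u) +
        Real.exp (-x * Real.cosh u + (ν - 1) * u)) / 2 := by
  rw [show -x * Real.cosh u + (ν + 1) * u = u + (-x * Real.cosh u + ν * u) by ring,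
    show -x * Real.cosh u + (ν - 1) * u = -u + (-x * Real.cosh u + ν * u) by ring,
    Real.exp_add u, Real.exp_add (-u), Real.cosh_eq]
  ring

lemma sinh_mul_exp_cosh (ν x u : ℝ) :
    Real.sinh u * Real.exp (-x * Real.cosh u + ν * u) =
      (Real.exp (-x * Real.cosh u + (ν + 1) * u) -
        Real.exp (-x * Real.cosh u + (ν - 1) * u)) / 2 := by
  rw [show -x * Real.cosh u + (ν + 1) * u = u + (-x * Real.cosh u + ν * u) by ring,
    show -x * Real.cosh u + (ν - 1) * u = -u + (-x * Real.cosh u + ν * u) by ring,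
    Real.exp_add u, Real.exp_add (-u), Real.sinh_eq]
  ring

lemma expCoshIntegral_pos (ν : ℝ) {x : ℝ} (hx : 0 < x) : 0 < expCoshIntegral ν x :=
  integral_pos_of_integrable_nonneg_nonzero (x := 0) (by fun_prop) (integrable_exp_cosh ν hx)
    (fun _ => (Real.exp_pos _).le) (Real.exp_pos _).ne'

lemma expCoshIntegral_neg (ν x : ℝ) : expCoshIntegral (-ν) x = expCoshIntegral ν x := by
  unfold expCoshIntegral
  rw [← integral_neg_eq_self]
  simp only [Real.cosh_neg, neg_mul_neg]

lemma expCoshIntegral_hasDerivAt (ν : ℝ) {x : ℝ} (hx : 0 < x) :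
    HasDerivAt (expCoshIntegral ν)
      (-((expCoshIntegral (ν + 1) x + expCoshIntegral (ν - 1) x) / 2)) x := by
  have hcosh (y : ℝ) (hy : 0 < y) :
      Integrable fun u : ℝ => Real.cosh u * Real.exp (-y * Real.cosh u + ν * u) := by
    simp only [cosh_mul_exp_cosh]
    exact ((integrable_exp_cosh _ hy).add (integrable_exp_cosh _ hy)).div_const 2
  have key := (hasDerivAt_integral_of_dominated_loc_of_deriv_le (μ := volume)
    (F := fun y u => Real.exp (-y * Real.cosh u + ν * u))
    (F' := fun y u => -(Real.cosh u * Real.exp (-y * Real.cosh u + ν * u)))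
    (bound := fun u => Real.cosh u * Real.exp (-(x / 2) * Real.cosh u + ν * u))
    (Ioi_mem_nhds (half_lt_self hx))
    (Filter.Eventually.of_forall fun y => by fun_prop)
    (integrable_exp_cosh ν hx) (by fun_prop)
    (ae_of_all _ fun u y hy => ?_) (hcosh _ (half_pos hx))
    (ae_of_all _ fun u y _ => ?_)).2
  · refine key.congr_deriv ?_
    rw [integral_neg]
    simp only [cosh_mul_exp_cosh]
    rw [integral_div, integral_add (integrable_exp_cosh _ hx) (integrable_exp_cosh _ hx)]
    rfl
  · rw [norm_neg, norm_mul, Real.norm_eq_abs, Real.norm_eq_abs, Real.abs_exp,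
      abs_of_pos (Real.cosh_pos u)]
    have hc := Real.cosh_pos u
    have hy' : x / 2 < y := hy
    gcongr
  · have h := (((hasDerivAt_id y).neg.mul_const (Real.cosh u)).add_const (ν * u)).exp
    refine h.congr_deriv ?_
    simp only [Pi.neg_apply, id]
    ring

lemma expCoshIntegral_recurrence (ν : ℝ) {x : ℝ} (hx : 0 < x) :
    x * (expCoshIntegral (ν + 1) x - expCoshIntegral (ν - 1) x) / 2 =
      ν * expCoshIntegral ν x := by
  have hi (μ : ℝ) := integrable_exp_cosh μ hx
  have hdiff : Integrable fun u : ℝ => x * ((Real.exp (-x * Real.cosh u + (ν + 1) * u) -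
        Real.exp (-x * Real.cosh u + (ν - 1) * u)) / 2) :=
    (((hi _).sub (hi _)).div_const 2).const_mul x
  have hint : Integrable fun u : ℝ => ν * Real.exp (-x * Real.cosh u + ν * u) -
      x * ((Real.exp (-x * Real.cosh u + (ν + 1) * u) -
        Real.exp (-x * Real.cosh u + (ν - 1) * u)) / 2) :=
    ((hi ν).const_mul ν).sub hdiff
  have hzero := integral_eq_zero_of_hasDerivAt_of_integrable (fun u => ?_) hint (hi ν)
  · rw [integral_sub ((hi ν).const_mul ν) hdiff, integral_const_mul, integral_const_mul,
      integral_div, integral_sub (hi _) (hi _)] at hzero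
    unfold expCoshIntegral
    linarith
  · have h := (((Real.hasDerivAt_cosh u).const_mul (-x)).add
      ((hasDerivAt_id u).const_mul ν)).exp
    refine h.congr_deriv ?_
    rw [← sinh_mul_exp_cosh]
    simp only [Pi.add_apply, id]
    ring

lemma besselK_eq_expCoshIntegral (ν : ℝ) {x : ℝ} (hx : 0 < x) :
    besselK ν x = expCoshIntegral ν x / 2 := by
  have hx2 : 0 < x / 2 := half_pos hx
  have himage : (fun u : ℝ => x / 2 * Real.exp (-u)) '' univ = Ioi 0 := by
    ext t
    constructor
    · rintro ⟨u, -, rfl⟩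
      exact mul_pos hx2 (Real.exp_pos _)
    · intro ht
      refine ⟨-Real.log (t / (x / 2)), mem_univ _, ?_⟩
      simp only [neg_neg]
      rw [Real.exp_log (div_pos ht hx2)]
      field_simp
  have hderiv (u : ℝ) : HasDerivAt (fun u : ℝ => x / 2 * Real.exp (-u))
      (-(x / 2 * Real.exp (-u))) u := by
    exact (((hasDerivAt_neg u).exp).const_mul (x / 2)).congr_deriv (by ring)
  have hinj : InjOn (fun u : ℝ => x / 2 * Real.exp (-u)) univ := fun u _ v _ h => by
    simpa using mul_left_cancel₀ hx2.ne' h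
  unfold besselK expCoshIntegral
  rw [← himage, integral_image_eq_integral_abs_deriv_smul MeasurableSet.univ
    (fun u _ => (hderiv u).hasDerivWithinAt) hinj, Measure.restrict_univ,
    ← integral_const_mul, ← integral_div]
  congr 1 with u
  have ht : 0 < x / 2 * Real.exp (-u) := mul_pos hx2 (Real.exp_pos _)
  have hpow : x / 2 * Real.exp (-u) * (x / 2 * Real.exp (-u)) ^ (-ν - 1) =
      (2 ^ ν / x ^ ν) * Real.exp (ν * u) := by
    rw [Real.rpow_sub_one ht.ne', mul_div_cancel₀ _ ht.ne', Real.mul_rpow hx2.le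
      (Real.exp_pos _).le, ← Real.exp_mul, Real.rpow_neg hx2.le,
      Real.div_rpow hx.le zero_le_two, inv_div, neg_mul_neg, mul_comm u]
  have hexp : -(x / 2 * Real.exp (-u)) - x ^ 2 / (4 * (x / 2 * Real.exp (-u))) =
      -x * Real.cosh u := by
    rw [Real.cosh_eq, Real.exp_neg]
    field_simp
    ring
  have hxν : x ^ ν ≠ 0 := (Real.rpow_pos_of_pos hx ν).ne'
  have h2ν : (2 : ℝ) ^ ν ≠ 0 := (Real.rpow_pos_of_pos two_pos ν).ne'
  rw [abs_neg, abs_of_pos ht, smul_eq_mul, hexp, mul_left_comm (x / 2 * Real.exp (-u)), hpow,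
    Real.exp_add, Real.rpow_add_one two_ne_zero]
  field_simp

lemma integrable_exp_mul_cosh (ν : ℝ) {x : ℝ} (hx : 0 < x) :
    Integrable fun u : ℝ => Real.exp (-x * Real.cosh u) * Real.cosh (ν * u) := by
  convert ((integrable_exp_cosh ν hx).add (integrable_exp_cosh (-ν) hx)).div_const 2 using 2 with u
  rw [Pi.add_apply, Real.exp_add, Real.exp_add, Real.cosh_eq (ν * u), neg_mul ν]
  ring

lemma integral_exp_mul_cosh (ν : ℝ) {x : ℝ} (hx : 0 < x) :
    ∫ u : ℝ, Real.exp (-x * Real.cosh u) * Real.cosh (ν * u) = expCoshIntegral ν x := by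
  have h : ∀ u : ℝ, Real.exp (-x * Real.cosh u) * Real.cosh (ν * u) =
      (Real.exp (-x * Real.cosh u + ν * u) + Real.exp (-x * Real.cosh u + -ν * u)) / 2 := by
    intro u
    rw [Real.exp_add, Real.exp_add, Real.cosh_eq (ν * u), neg_mul ν]
    ring
  simp only [h]
  rw [integral_div, integral_add (integrable_exp_cosh _ hx) (integrable_exp_cosh _ hx)]
  change (expCoshIntegral ν x + expCoshIntegral (-ν) x) / 2 = _
  rw [expCoshIntegral_neg]
  ring

/-- `u ↦ cosh (b u) / cosh (c u)` is strictly increasing on `[0, ∞)` when `0 ≤ c < b`. -/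
lemma cosh_mul_cosh_lt {b c u v : ℝ} (hc : 0 ≤ c) (hcb : c < b) (huv : |v| < |u|) :
    Real.cosh (b * v) * Real.cosh (c * u) < Real.cosh (b * u) * Real.cosh (c * v) := by
  have habs (d w : ℝ) (hd : 0 ≤ d) : Real.cosh (d * w) = Real.cosh (d * |w|) := by
    rw [← Real.cosh_abs, abs_mul, abs_of_nonneg hd]
  have hb : 0 ≤ b := hc.trans hcb.le
  rw [habs b v hb, habs c u hc, habs b u hb, habs c v hc]
  have hv := abs_nonneg v
  generalize |v| = v at *
  generalize |u| = u at *
  have hprod (p q : ℝ) : Real.cosh p * Real.cosh q =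
      (Real.cosh (p + q) + Real.cosh (p - q)) / 2 := by
    rw [Real.cosh_add, Real.cosh_sub]
    ring
  rw [hprod, hprod]
  have hplus : Real.cosh (b * v + c * u) < Real.cosh (b * u + c * v) := by
    rw [Real.cosh_lt_cosh, abs_of_nonneg (by nlinarith), abs_of_nonneg (by nlinarith)]
    nlinarith
  have hminus : Real.cosh (b * v - c * u) ≤ Real.cosh (b * u - c * v) := by
    rw [Real.cosh_le_cosh, abs_of_nonneg (a := b * u - c * v) (by nlinarith), abs_le]
    constructor <;> nlinarith
  linarith

/-- Chebyshev's correlation inequality, saying that `K_b / K_c` is strictly decreasing. -/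
lemma expCoshIntegral_correlation {b c x : ℝ} (hc : 0 ≤ c) (hcb : c < b) (hx : 0 < x) :
    expCoshIntegral b x * (expCoshIntegral (c + 1) x + expCoshIntegral (c - 1) x) <
      (expCoshIntegral (b + 1) x + expCoshIntegral (b - 1) x) * expCoshIntegral c x := by
  have hQ := expCoshIntegral_pos c hx
  obtain ⟨m, hm⟩ : ∃ m, expCoshIntegral b x = m * expCoshIntegral c x :=
    ⟨_, (div_mul_cancel₀ _ hQ.ne').symm⟩
  have hi (ν : ℝ) := integrable_exp_mul_cosh ν hx
  have hdiff : Integrable fun u : ℝ => Real.exp (-x * Real.cosh u) * Real.cosh (b * u) -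
      m * (Real.exp (-x * Real.cosh u) * Real.cosh (c * u)) := (hi b).sub ((hi c).const_mul m)
  have hzero : ∫ u : ℝ, (Real.exp (-x * Real.cosh u) * Real.cosh (b * u) -
      m * (Real.exp (-x * Real.cosh u) * Real.cosh (c * u))) = 0 := by
    rw [integral_sub (hi b) ((hi c).const_mul m), integral_const_mul,
      integral_exp_mul_cosh _ hx, integral_exp_mul_cosh _ hx, hm, sub_self]
  obtain ⟨v, hv⟩ : ∃ v : ℝ, Real.exp (-x * Real.cosh v) * Real.cosh (b * v) -
      m * (Real.exp (-x * Real.cosh v) * Real.cosh (c * v)) = 0 := by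
    refine mem_range_of_exists_le_of_exists_ge (by fun_prop) ?_ ?_
    · by_contra! h
      exact (integral_pos_of_integrable_nonneg_nonzero (x := 0) (by fun_prop) hdiff
        (fun u => (h u).le) (h 0).ne').ne' hzero
    · by_contra! h
      refine (integral_pos_of_integrable_nonneg_nonzero (x := 0) (by fun_prop) hdiff.neg
        (fun u => ?_) (neg_pos.mpr (h 0)).ne').ne' ?_
      · exact (neg_pos.mpr (h u)).le
      · simp only [Pi.neg_apply]
        rw [integral_neg, hzero, neg_zero]
  have hmv : Real.cosh (b * v) = m * Real.cosh (c * v) := by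
    have := Real.exp_pos (-x * Real.cosh v)
    apply mul_left_cancel₀ this.ne'
    linarith
  have hcv := Real.cosh_pos (c * v)
  have hsign (u : ℝ) (huv : |v| ≠ |u|) :
      0 < (Real.cosh u - Real.cosh v) * (Real.cosh (b * u) - m * Real.cosh (c * u)) := by
    rcases huv.lt_or_gt with h | h
    · have h1 := Real.cosh_lt_cosh.mpr h
      have h2 := cosh_mul_cosh_lt hc hcb h
      rw [hmv] at h2
      exact mul_pos (by linarith) (by nlinarith)
    · have h1 := Real.cosh_lt_cosh.mpr h
      have h2 := cosh_mul_cosh_lt hc hcb h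
      rw [hmv] at h2
      exact mul_pos_of_neg_of_neg (by linarith) (by nlinarith)
  have hnonneg (u : ℝ) :
      0 ≤ (Real.cosh u - Real.cosh v) * (Real.cosh (b * u) - m * Real.cosh (c * u)) := by
    by_cases huv : |v| = |u|
    · rw [← Real.cosh_abs u, ← huv, Real.cosh_abs, sub_self, zero_mul]
    · exact (hsign u huv).le
  have hcosh (ν u : ℝ) : Real.cosh u * Real.cosh (ν * u) =
      (Real.cosh ((ν + 1) * u) + Real.cosh ((ν - 1) * u)) / 2 := by
    rw [add_mul, sub_mul, one_mul, Real.cosh_add, Real.cosh_sub]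
    ring
  have hi' (ν : ℝ) : Integrable fun u : ℝ =>
      (Real.exp (-x * Real.cosh u) * Real.cosh ((ν + 1) * u) +
        Real.exp (-x * Real.cosh u) * Real.cosh ((ν - 1) * u)) / 2 :=
    ((hi _).add (hi _)).div_const 2
  have hval (ν : ℝ) : ∫ u : ℝ, (Real.exp (-x * Real.cosh u) * Real.cosh ((ν + 1) * u) +
        Real.exp (-x * Real.cosh u) * Real.cosh ((ν - 1) * u)) / 2 =
      (expCoshIntegral (ν + 1) x + expCoshIntegral (ν - 1) x) / 2 := by
    rw [integral_div, integral_add (hi _) (hi _), integral_exp_mul_cosh _ hx,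
      integral_exp_mul_cosh _ hx]
  have heq : (fun u : ℝ => Real.exp (-x * Real.cosh u) *
      ((Real.cosh u - Real.cosh v) * (Real.cosh (b * u) - m * Real.cosh (c * u)))) = fun u =>
      ((Real.exp (-x * Real.cosh u) * Real.cosh ((b + 1) * u) +
        Real.exp (-x * Real.cosh u) * Real.cosh ((b - 1) * u)) / 2 -
      m * ((Real.exp (-x * Real.cosh u) * Real.cosh ((c + 1) * u) +
        Real.exp (-x * Real.cosh u) * Real.cosh ((c - 1) * u)) / 2)) -
      Real.cosh v * (Real.exp (-x * Real.cosh u) * Real.cosh (b * u) -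
        m * (Real.exp (-x * Real.cosh u) * Real.cosh (c * u))) := by
    funext u
    linear_combination Real.exp (-x * Real.cosh u) * (hcosh b u - m * hcosh c u)
  have hfirst : Integrable fun u : ℝ =>
      (Real.exp (-x * Real.cosh u) * Real.cosh ((b + 1) * u) +
        Real.exp (-x * Real.cosh u) * Real.cosh ((b - 1) * u)) / 2 -
      m * ((Real.exp (-x * Real.cosh u) * Real.cosh ((c + 1) * u) +
        Real.exp (-x * Real.cosh u) * Real.cosh ((c - 1) * u)) / 2) :=
    (hi' b).sub ((hi' c).const_mul m)
  have hpos : 0 < ∫ u : ℝ, Real.exp (-x * Real.cosh u) *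
      ((Real.cosh u - Real.cosh v) * (Real.cosh (b * u) - m * Real.cosh (c * u))) := by
    refine integral_pos_of_integrable_nonneg_nonzero (x := |v| + 1) (by fun_prop) ?_
      (fun u => mul_nonneg (Real.exp_pos _).le (hnonneg u))
      (mul_pos (Real.exp_pos _) (hsign _ ?_)).ne'
    · rw [heq]
      exact hfirst.sub (hdiff.const_mul _)
    · rw [abs_of_nonneg (by positivity : 0 ≤ |v| + 1)]
      exact (lt_add_one _).ne
  rw [heq, integral_sub hfirst (hdiff.const_mul _), integral_const_mul, hzero,
    integral_sub (hi' b) ((hi' c).const_mul m), integral_const_mul, hval, hval] at hpos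
  rw [hm]
  nlinarith

lemma expCoshIntegral_hasDerivAt_lower (α : ℝ) {x : ℝ} (hx : 0 < x) :
    HasDerivAt (expCoshIntegral α)
      (-(α / x) * expCoshIntegral α x - expCoshIntegral (1 - α) x) x := by
  have h := expCoshIntegral_recurrence α hx
  have hs := expCoshIntegral_neg (1 - α) x
  rw [neg_sub] at hs
  convert expCoshIntegral_hasDerivAt α hx using 1
  rw [hs] at h ⊢
  field_simp
  linarith

lemma expCoshIntegral_ratio_bound_of_large {α x : ℝ} (hα : 0 ≤ α) (hα' : α < 1 / 2) (hx : 0 < x)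
    (hx' : 3 / 4 - α ≤ x ^ 2) :
    x * expCoshIntegral (1 - α) x < (x ^ 2 + (3 / 4 - α)) * expCoshIntegral α x := by
  have hcor := expCoshIntegral_correlation hα (by linarith : α < 1 - α) hx
  have hP := (expCoshIntegral_hasDerivAt (1 - α) hx).unique
    (expCoshIntegral_hasDerivAt_lower (1 - α) hx)
  have hQ := (expCoshIntegral_hasDerivAt α hx).unique (expCoshIntegral_hasDerivAt_lower α hx)
  have hPpos := expCoshIntegral_pos (1 - α) hx
  have hQpos := expCoshIntegral_pos α hx
  rw [sub_sub_cancel] at hP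
  set P := expCoshIntegral (1 - α) x
  set Q := expCoshIntegral α x
  have hquad : (x * P) ^ 2 - (1 - 2 * α) * (x * P) * Q - x ^ 2 * Q ^ 2 < 0 := by
    have h1 : P * (α / x * Q + P) < ((1 - α) / x * P + Q) * Q := by nlinarith
    have h2 := mul_lt_mul_of_pos_left h1 (pow_pos hx 2)
    have h3 : x ^ 2 * (P * (α / x * Q + P)) = x * α * P * Q + x ^ 2 * P ^ 2 := by
      field_simp
    have h4 : x ^ 2 * (((1 - α) / x * P + Q) * Q) =
        x * (1 - α) * P * Q + x ^ 2 * Q ^ 2 := by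
      field_simp
    nlinarith
  by_contra! hle
  have hsub : 0 < (x ^ 2 + 1 / 4) * Q := by positivity
  have h1 : (x ^ 2 + 1 / 4) * Q ≤ x * P - (1 / 2 - α) * Q := by linarith
  have h2 := pow_le_pow_left₀ hsub.le h1 2
  have h3 : 0 ≤ ((x ^ 2 - 1 / 4) ^ 2 - (1 / 2 - α) ^ 2) * Q ^ 2 := by
    apply mul_nonneg _ (sq_nonneg Q)
    nlinarith
  linarith

lemma expCoshIntegral_ratio_bound {α x : ℝ} (hα : 0 ≤ α) (hα' : α < 1 / 2) (hx : 0 < x) :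
    x * expCoshIntegral (1 - α) x < (x ^ 2 + (3 / 4 - α)) * expCoshIntegral α x := by
  rcases le_or_gt (3 / 4 - α) (x ^ 2) with hlarge | hsmall
  · exact expCoshIntegral_ratio_bound_of_large hα hα' hx hlarge
  have hc : 0 < 3 / 4 - α := by linarith
  set z := √(3 / 4 - α)
  have hz : z ^ 2 = 3 / 4 - α := Real.sq_sqrt hc.le
  have hxz : x < z := Real.lt_sqrt_of_sq_lt hsmall
  have hend := expCoshIntegral_ratio_bound_of_large hα hα' (hx.trans hxz) hz.ge
  -- the integrating factor `y ^ (-3/4) * exp (-y ^ 2 / 2)` turns the differential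
  -- inequality for the difference of the two sides into a monotonicity statement
  let D : ℝ → ℝ := fun y =>
    y * expCoshIntegral (1 - α) y - (y ^ 2 + (3 / 4 - α)) * expCoshIntegral α y
  let μ : ℝ → ℝ := fun y => y ^ (-(3 / 4) : ℝ) * Real.exp (-y ^ 2 / 2)
  have hμpos (y : ℝ) (hy : 0 < y) : 0 < μ y :=
    mul_pos (Real.rpow_pos_of_pos hy _) (Real.exp_pos _)
  have hμ (y : ℝ) (hy : 0 < y) : HasDerivAt μ (-(3 / 4 / y + y) * μ y) y := by
    refine ((Real.hasDerivAt_rpow_const (p := -(3 / 4)) (Or.inl hy.ne')).mul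
      (((hasDerivAt_pow 2 y).neg.div_const 2).exp)).congr_deriv ?_
    rw [Real.rpow_sub_one hy.ne']
    simp only [μ, Pi.neg_apply]
    push_cast
    field_simp
    ring
  have hD (y : ℝ) (hy : 0 < y) : HasDerivAt D
      ((3 / 4 / y + y) * D y + ((y ^ 2 - 3 / 4) ^ 2 - α ^ 2) / y * expCoshIntegral α y) y := by
    have hP := expCoshIntegral_hasDerivAt_lower (1 - α) hy
    rw [sub_sub_cancel] at hP
    refine (((hasDerivAt_id y).mul hP).sub (((hasDerivAt_pow 2 y).add_const (3 / 4 - α)).mul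
      (expCoshIntegral_hasDerivAt_lower α hy))).congr_deriv ?_
    simp only [D, id]
    push_cast
    field_simp
    ring
  have hprod (y : ℝ) (hy : 0 < y) := (hμ y hy).mul (hD y hy)
  have hmono : StrictMonoOn (μ * D) (Icc x z) := by
    refine strictMonoOn_of_deriv_pos (convex_Icc x z)
      (fun y hy => (hprod y (hx.trans_le hy.1)).continuousAt.continuousWithinAt) fun y hy => ?_
    rw [interior_Icc] at hy
    have hy0 : 0 < y := hx.trans hy.1
    rw [(hprod y hy0).deriv]
    have hyz : y ^ 2 < 3 / 4 - α := by
      rw [← hz]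
      exact pow_lt_pow_left₀ hy.2 hy0.le two_ne_zero
    have hpos : 0 < μ y * (((y ^ 2 - 3 / 4) ^ 2 - α ^ 2) / y * expCoshIntegral α y) := by
      refine mul_pos (hμpos y hy0) (mul_pos (div_pos ?_ hy0) (expCoshIntegral_pos α hy0))
      nlinarith
    linarith
  have hlt := hmono (left_mem_Icc.mpr hxz.le) (right_mem_Icc.mpr hxz.le) hxz
  have hneg : μ z * D z < 0 :=
    mul_neg_of_pos_of_neg (hμpos z (hx.trans hxz)) (sub_neg.mpr hend)
  exact sub_neg.mp (neg_of_mul_neg_right (hlt.trans hneg) (hμpos x hx).le)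

/-- For every `α ∈ [0, 1/2)` and `x ≥ 0`,
`1 − α − x·K_{1−α}(x)/K_α(x) > −x² + 1/4`, with `x·K_{1−α}(x)/K_α(x) := 0` at `x = 0`. -/
theorem besselK_ratio_lower_bound (α x : ℝ) (hα : 0 ≤ α) (hα' : α < 1 / 2) (hx : 0 ≤ x) :
    1 - α - (if x = 0 then 0 else x * besselK (1 - α) x / besselK α x) >
      -x ^ 2 + 1 / 4 := by
  split_ifs with h
  · subst h
    norm_num
    linarith
  · have hx0 : 0 < x := lt_of_le_of_ne hx (Ne.symm h)
    have hQ := expCoshIntegral_pos α hx0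
    have hb := expCoshIntegral_ratio_bound hα hα' hx0
    have hlt : x * besselK (1 - α) x / besselK α x < x ^ 2 + (3 / 4 - α) := by
      rw [besselK_eq_expCoshIntegral _ hx0, besselK_eq_expCoshIntegral _ hx0,
        div_lt_iff₀ (half_pos hQ)]
      linarith
    linarith
end

section
/- There exists a universal constant C ∈ (0, ∞) such that K_ε(x) ≤ C·x^{−1/2}·e^{−x} for all ε ∈ [0, 1/2] and all x > 0; moreover, for every M ∈ (0, ∞) there exists c(M) ∈ (0, ∞) such that K_ε(x) ≥ c(M)·x^{−1/2}·e^{−x} for all ε ∈ [0, 1/2] and all x ≥ M. -/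
open MeasureTheory Set

/-- The integrand of `besselK`, with the prefactor absorbed. -/
noncomputable def besselKIntegrand (ν x t : ℝ) : ℝ :=
  Real.exp (-t - x ^ 2 / (4 * t)) * ((2 * t / x) ^ (-ν) / (2 * t))

lemma besselK_eq_integral (ν : ℝ) {x : ℝ} (hx : 0 < x) :
    besselK ν x = ∫ t in Ioi (0 : ℝ), besselKIntegrand ν x t := by
  unfold besselK besselKIntegrand
  rw [← integral_const_mul]
  refine setIntegral_congr_fun measurableSet_Ioi fun t ht => ?_
  have ht : 0 < t := ht
  have h : x ^ ν / 2 ^ (ν + 1) * t ^ (-ν - 1) = (2 * t / x) ^ (-ν) / (2 * t) := by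
    rw [Real.div_rpow (by positivity) hx.le, Real.mul_rpow (by norm_num) ht.le,
      Real.rpow_sub ht, Real.rpow_add (by norm_num), Real.rpow_one, Real.rpow_one,
      Real.rpow_neg hx.le, Real.rpow_neg ht.le, Real.rpow_neg (by norm_num)]
    have := Real.rpow_pos_of_pos hx ν
    have := Real.rpow_pos_of_pos ht ν
    field_simp
  change _ = _
  rw [← h]
  ring

lemma besselKIntegrand_nonneg (ν : ℝ) {x t : ℝ} (hx : 0 < x) (ht : 0 < t) :
    0 ≤ besselKIntegrand ν x t := by
  unfold besselKIntegrand
  positivity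

lemma measurable_besselKIntegrand (ν x : ℝ) : Measurable (besselKIntegrand ν x) := by
  unfold besselKIntegrand
  fun_prop

/-- The change of variables turning the `besselK` phase into a Gaussian. -/
noncomputable def besselPhase (x t : ℝ) : ℝ :=
  √(2 * t / x) - (√(2 * t / x))⁻¹

lemma hasDerivAt_besselPhase {x t : ℝ} (hx : 0 < x) (ht : 0 < t) :
    HasDerivAt (besselPhase x) ((√(2 * t / x) + (√(2 * t / x))⁻¹) / (2 * t)) t := by
  have hq : 0 < 2 * t / x := by positivity
  have hr : 0 < √(2 * t / x) := Real.sqrt_pos.2 hq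
  have hrr : √(2 * t / x) ^ 2 = 2 * t / x := Real.sq_sqrt hq.le
  have hlin : HasDerivAt (fun s : ℝ => 2 * s / x) (2 / x) t := by
    simpa using ((hasDerivAt_id t).const_mul 2).div_const x
  have hsqrt := hlin.sqrt hq.ne'
  refine (hsqrt.sub (hsqrt.inv hr.ne')).congr_deriv ?_
  have htx : t = x * √(2 * t / x) ^ 2 / 2 := by rw [hrr]; field_simp
  generalize √(2 * t / x) = r at *
  subst htx
  field_simp
  ring

lemma strictMonoOn_besselPhase {x : ℝ} (hx : 0 < x) :
    StrictMonoOn (besselPhase x) (Ioi 0) := by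
  intro a ha b hb hab
  have ha : 0 < a := ha
  have hr : 0 < √(2 * a / x) := Real.sqrt_pos.2 (by positivity)
  have hlt : √(2 * a / x) < √(2 * b / x) := Real.sqrt_lt_sqrt (by positivity) (by gcongr)
  have := inv_strictAnti₀ hr hlt
  unfold besselPhase
  linarith

lemma besselPhase_sq {x t : ℝ} (hx : 0 < x) (ht : 0 < t) :
    -x + -(x / 2) * besselPhase x t ^ 2 = -t - x ^ 2 / (4 * t) := by
  have hq : 0 < 2 * t / x := by positivity
  have hr : 0 < √(2 * t / x) := Real.sqrt_pos.2 hq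
  have hrr : √(2 * t / x) ^ 2 = 2 * t / x := Real.sq_sqrt hq.le
  unfold besselPhase
  have htx : t = x * √(2 * t / x) ^ 2 / 2 := by rw [hrr]; field_simp
  generalize √(2 * t / x) = r at *
  subst htx
  field_simp
  ring

lemma rpow_neg_le_sqrt_add_inv {ν q : ℝ} (hν : ν ∈ Icc (0 : ℝ) (1 / 2)) (hq : 0 < q) :
    q ^ (-ν) ≤ √q + (√q)⁻¹ := by
  have hr : 0 < √q := Real.sqrt_pos.2 hq
  rcases le_total 1 q with h | h
  · have h1 : q ^ (-ν) ≤ 1 := Real.rpow_le_one_of_one_le_of_nonpos h (by linarith [hν.1])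
    have h2 : 1 ≤ √q := Real.one_le_sqrt.2 h
    have := inv_pos.2 hr
    linarith
  · have h1 : q ^ (-ν) ≤ q ^ (-(1 / 2) : ℝ) :=
      Real.rpow_le_rpow_of_exponent_ge hq h (by linarith [hν.2])
    rw [Real.rpow_neg hq.le (1 / 2), ← Real.sqrt_eq_rpow] at h1
    linarith

/-- The Gaussian majorant of the `besselK` integrand, as a pulled-back density. -/
noncomputable def besselKMajorant (x t : ℝ) : ℝ :=
  |(√(2 * t / x) + (√(2 * t / x))⁻¹) / (2 * t)| •
    (Real.exp (-x) * Real.exp (-(x / 2) * besselPhase x t ^ 2))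

lemma besselKIntegrand_le_majorant {ν x t : ℝ} (hν : ν ∈ Icc (0 : ℝ) (1 / 2)) (hx : 0 < x)
    (ht : 0 < t) : besselKIntegrand ν x t ≤ besselKMajorant x t := by
  unfold besselKIntegrand besselKMajorant
  rw [← Real.exp_add, besselPhase_sq hx ht, abs_of_nonneg (by positivity), smul_eq_mul, mul_comm]
  gcongr
  exact rpow_neg_le_sqrt_add_inv hν (by positivity)

lemma integrable_exp_mul_gaussian {x : ℝ} (hx : 0 < x) :
    Integrable fun y : ℝ => Real.exp (-x) * Real.exp (-(x / 2) * y ^ 2) :=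
  (integrable_exp_neg_mul_sq (half_pos hx)).const_mul _

lemma integrableOn_besselKMajorant {x : ℝ} (hx : 0 < x) :
    IntegrableOn (besselKMajorant x) (Ioi 0) :=
  (integrableOn_image_iff_integrableOn_abs_deriv_smul measurableSet_Ioi
    (fun _ ht => (hasDerivAt_besselPhase hx ht).hasDerivWithinAt)
    (strictMonoOn_besselPhase hx).injOn _).1 (integrable_exp_mul_gaussian hx).integrableOn

lemma integral_besselKMajorant_le {x : ℝ} (hx : 0 < x) :
    ∫ t in Ioi (0 : ℝ), besselKMajorant x t ≤ Real.exp (-x) * √(Real.pi / (x / 2)) := by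
  rw [← integral_gaussian, ← integral_const_mul]
  refine (integral_image_eq_integral_abs_deriv_smul measurableSet_Ioi
    (fun _ ht => (hasDerivAt_besselPhase hx ht).hasDerivWithinAt)
    (strictMonoOn_besselPhase hx).injOn
    fun y => Real.exp (-x) * Real.exp (-(x / 2) * y ^ 2)).symm.trans_le ?_
  exact setIntegral_le_integral (integrable_exp_mul_gaussian hx)
    (Filter.Eventually.of_forall fun y => by positivity)

lemma integrableOn_besselKIntegrand {ν x : ℝ} (hν : ν ∈ Icc (0 : ℝ) (1 / 2)) (hx : 0 < x) :
    IntegrableOn (besselKIntegrand ν x) (Ioi 0) := by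
  refine (integrableOn_besselKMajorant hx).mono'
    (measurable_besselKIntegrand ν x).aestronglyMeasurable ?_
  filter_upwards [ae_restrict_mem measurableSet_Ioi] with t ht
  rw [Real.norm_of_nonneg (besselKIntegrand_nonneg ν hx ht)]
  exact besselKIntegrand_le_majorant hν hx ht

lemma rpow_neg_one_div_two {x : ℝ} (hx : 0 < x) : x ^ (-(1 : ℝ) / 2) = (√x)⁻¹ := by
  rw [neg_div, Real.rpow_neg hx.le, ← Real.sqrt_eq_rpow]

lemma besselK_le {ν x : ℝ} (hν : ν ∈ Icc (0 : ℝ) (1 / 2)) (hx : 0 < x) :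
    besselK ν x ≤ √(2 * Real.pi) * x ^ (-(1 : ℝ) / 2) * Real.exp (-x) := by
  rw [besselK_eq_integral ν hx, rpow_neg_one_div_two hx]
  calc ∫ t in Ioi (0 : ℝ), besselKIntegrand ν x t
      ≤ ∫ t in Ioi (0 : ℝ), besselKMajorant x t :=
        setIntegral_mono_on (integrableOn_besselKIntegrand hν hx)
          (integrableOn_besselKMajorant hx) measurableSet_Ioi
          fun t ht => besselKIntegrand_le_majorant hν hx ht
    _ ≤ Real.exp (-x) * √(Real.pi / (x / 2)) := integral_besselKMajorant_le hx
    _ = √(2 * Real.pi) * (√x)⁻¹ * Real.exp (-x) := by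
        rw [show Real.pi / (x / 2) = 2 * Real.pi / x by field_simp,
          Real.sqrt_div (by positivity)]
        ring

lemma le_besselKIntegrand {ν x t S : ℝ} (hν : ν ∈ Icc (0 : ℝ) (1 / 2)) (hx : 0 < x)
    (hS : 1 + 2 / √x ≤ S) (ht : t ∈ Icc (x / 2) (x / 2 + √x)) :
    Real.exp (-x - 2) * (S⁻¹ / (S * x)) ≤ besselKIntegrand ν x t := by
  obtain ⟨hl, hu⟩ := ht
  have ht0 : 0 < t := by linarith
  have hr : 0 < √x := Real.sqrt_pos.2 hx
  have hrr : √x ^ 2 = x := Real.sq_sqrt hx.le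
  have hq1 : 1 ≤ 2 * t / x := by rw [le_div_iff₀ hx]; linarith
  have hqS : 2 * t / x ≤ S := by
    refine le_trans ?_ hS
    rw [div_le_iff₀ hx]
    have : (1 + 2 / √x) * x = x + 2 * √x := by
      generalize √x = r at *
      subst hrr
      field_simp
    linarith
  have hS0 : 0 < S := by linarith
  unfold besselKIntegrand
  gcongr ?_ * (?_ / ?_)
  · have hsq : (t - x / 2) ^ 2 ≤ 2 * t := by
      have : (t - x / 2) ^ 2 ≤ √x ^ 2 := by gcongr; linarith
      linarith
    have hid : t + x ^ 2 / (4 * t) = x + (t - x / 2) ^ 2 / t := by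
      field_simp
      ring
    have : (t - x / 2) ^ 2 / t ≤ 2 := by rwa [div_le_iff₀ ht0]
    exact Real.exp_le_exp.2 (by linarith)
  · calc S⁻¹ ≤ (2 * t / x)⁻¹ := by gcongr
      _ = (2 * t / x) ^ (-1 : ℝ) := (Real.rpow_neg_one _).symm
      _ ≤ (2 * t / x) ^ (-ν) :=
        Real.rpow_le_rpow_of_exponent_le hq1 (by linarith [hν.2])
  · rwa [div_le_iff₀ hx] at hqS

lemma le_besselK {ν x S : ℝ} (hν : ν ∈ Icc (0 : ℝ) (1 / 2)) (hx : 0 < x)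
    (hS : 1 + 2 / √x ≤ S) :
    Real.exp (-2) / S ^ 2 * x ^ (-(1 : ℝ) / 2) * Real.exp (-x) ≤ besselK ν x := by
  have hr : 0 < √x := Real.sqrt_pos.2 hx
  have hS0 : 0 < S := lt_of_lt_of_le (by positivity) hS
  have hsub : Icc (x / 2) (x / 2 + √x) ⊆ Ioi 0 := fun t ht => (half_pos hx).trans_le ht.1
  have hint := integrableOn_besselKIntegrand hν hx
  rw [besselK_eq_integral ν hx, rpow_neg_one_div_two hx]
  calc Real.exp (-2) / S ^ 2 * (√x)⁻¹ * Real.exp (-x)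
      = ∫ _t in Icc (x / 2) (x / 2 + √x), Real.exp (-x - 2) * (S⁻¹ / (S * x)) := by
        rw [setIntegral_const, Real.volume_real_Icc_of_le (by linarith), smul_eq_mul,
          sub_eq_add_neg (-x), Real.exp_add]
        have hrr : √x ^ 2 = x := Real.sq_sqrt hx.le
        generalize √x = r at *
        subst hrr
        field_simp
        ring
    _ ≤ ∫ t in Icc (x / 2) (x / 2 + √x), besselKIntegrand ν x t :=
        setIntegral_mono_on (integrableOn_const (by simp)) (hint.mono_set hsub)
          measurableSet_Icc fun t ht => le_besselKIntegrand hν hx hS ht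
    _ ≤ ∫ t in Ioi (0 : ℝ), besselKIntegrand ν x t := by
        refine setIntegral_mono_set hint ?_ hsub.eventuallyLE
        filter_upwards [ae_restrict_mem measurableSet_Ioi] with t ht
        exact besselKIntegrand_nonneg ν hx ht

/-- There is a universal `C ∈ (0, ∞)` with `K_ε(x) ≤ C·x^{−1/2}·e^{−x}` for all
`ε ∈ [0, 1/2]`, `x > 0`; moreover, for every `M ∈ (0, ∞)` there is `c(M) ∈ (0, ∞)`
with `K_ε(x) ≥ c(M)·x^{−1/2}·e^{−x}` for all `ε ∈ [0, 1/2]`, `x ≥ M`. -/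
theorem besselK_two_sided_bounds :
    (∃ C : ℝ, 0 < C ∧
      ∀ ε x : ℝ, ε ∈ Set.Icc (0 : ℝ) (1 / 2) → 0 < x →
        besselK ε x ≤ C * x ^ (-(1 : ℝ) / 2) * Real.exp (-x)) ∧
    ∀ M : ℝ, 0 < M → ∃ c : ℝ, 0 < c ∧
      ∀ ε x : ℝ, ε ∈ Set.Icc (0 : ℝ) (1 / 2) → M ≤ x →
        c * x ^ (-(1 : ℝ) / 2) * Real.exp (-x) ≤ besselK ε x := by
  refine ⟨⟨√(2 * Real.pi), by positivity, fun ε x hε hx => besselK_le hε hx⟩, fun M hM => ?_⟩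
  have hr : 0 < √M := Real.sqrt_pos.2 hM
  refine ⟨Real.exp (-2) / (1 + 2 / √M) ^ 2, by positivity, fun ε x hε hx => ?_⟩
  exact le_besselK hε (hM.trans_le hx) (by gcongr)
end

section
/- For every α₀ ∈ (0, 1/2) there exist constants c₁ ∈ (0, ∞) (universal) and c₂(α₀) ∈ (0, ∞) such that for all α ∈ (0, α₀]: (i) x^α K_α(x) ≥ c₁ for all x ∈ (0, 2], and (ii) x^α K_α(x) ≥ c₂(α₀)·x^{−1/2}·e^{−x} for all x ∈ [2, ∞). -/
open MeasureTheory Set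

/-- The integrand of `besselK ν x` is integrable when `ν < 1`. -/
lemma integrableOn_besselK_integrand {ν x : ℝ} (hν : ν < 1) (hx : 0 < x) :
    IntegrableOn (fun t : ℝ => Real.exp (-t - x ^ 2 / (4 * t)) * t ^ (-ν - 1)) (Ioi 0) := by
  have hGamma := (Real.GammaIntegral_convergent (s := 1 - ν) (by linarith)).const_mul (4 / x ^ 2)
  refine Integrable.mono' hGamma (by fun_prop) ?_
  filter_upwards [ae_restrict_mem measurableSet_Ioi] with t ht
  have ht0 : 0 < t := ht
  have hinv : Real.exp (-(x ^ 2 / (4 * t))) ≤ 4 / x ^ 2 * t := by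
    rw [Real.exp_neg, inv_le_comm₀ (Real.exp_pos _) (by positivity)]
    calc (4 / x ^ 2 * t)⁻¹ = x ^ 2 / (4 * t) := by field_simp
      _ ≤ Real.exp (x ^ 2 / (4 * t)) := by linarith [Real.add_one_le_exp (x ^ 2 / (4 * t))]
  have hpow : t ^ (1 - ν - 1) = t * t ^ (-ν - 1) := by
    rw [mul_comm, ← Real.rpow_add_one ht0.ne']
    ring_nf
  rw [Real.norm_of_nonneg (by positivity), sub_eq_add_neg, Real.exp_add, hpow]
  calc Real.exp (-t) * Real.exp (-(x ^ 2 / (4 * t))) * t ^ (-ν - 1)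
      ≤ Real.exp (-t) * (4 / x ^ 2 * t) * t ^ (-ν - 1) := by gcongr
    _ = 4 / x ^ 2 * (Real.exp (-t) * (t * t ^ (-ν - 1))) := by ring

/-- A lower bound for `x ^ ν * besselK ν x` from restricting the integral to `[a, b]`. -/
lemma le_rpow_mul_besselK {ν x a b m : ℝ} (hν : ν < 1) (hν' : -1 ≤ ν) (hx : 0 < x) (ha : 0 < a)
    (hab : a ≤ b) (hm : ∀ t ∈ Icc a b, t + x ^ 2 / (4 * t) ≤ m) :
    x ^ ν * (x ^ ν / 2 ^ (ν + 1) * (Real.exp (-m) * b ^ (-ν - 1) * (b - a))) ≤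
      x ^ ν * besselK ν x := by
  have hint := integrableOn_besselK_integrand hν hx
  have hsub : Icc a b ⊆ Ioi 0 := fun t ht => ha.trans_le ht.1
  unfold besselK
  gcongr
  calc Real.exp (-m) * b ^ (-ν - 1) * (b - a)
      = Real.exp (-m) * b ^ (-ν - 1) * volume.real (Icc a b) := by
        rw [Real.volume_real_Icc_of_le hab]
    _ ≤ ∫ t in Icc a b, Real.exp (-t - x ^ 2 / (4 * t)) * t ^ (-ν - 1) := by
        refine setIntegral_ge_of_const_le_real measurableSet_Icc (by simp) (fun t ht => ?_)
          (hint.mono_set hsub)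
        have ht0 : 0 < t := hsub ht
        refine mul_le_mul (Real.exp_le_exp.2 (by linarith [hm t ht])) ?_
          (by have := ha.trans_le hab; positivity) (Real.exp_pos _).le
        exact Real.rpow_le_rpow_of_nonpos ht0 ht.2 (by linarith)
    _ ≤ _ := by
        refine setIntegral_mono_set hint ?_ hsub.eventuallyLE
        filter_upwards [ae_restrict_mem measurableSet_Ioi] with t ht
        have ht0 : 0 < t := ht
        exact (by positivity : 0 ≤ Real.exp (-t - x ^ 2 / (4 * t)) * t ^ (-ν - 1))

/-- `x ^ α * besselK α x` is bounded below on `(0, 2]`, uniformly in `α ∈ [0, 1)`. -/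
lemma rpow_mul_besselK_ge_of_le_two {α x : ℝ} (hα : 0 ≤ α) (hα' : α < 1) (hx : 0 < x)
    (hx2 : x ≤ 2) : Real.exp (-3) / 4 ≤ x ^ α * besselK α x := by
  have hsq : x ^ 2 ≤ 4 := by nlinarith
  refine le_trans ?_ (le_rpow_mul_besselK (a := x ^ 2 / 8) (b := x ^ 2 / 4) (m := 3) hα'
    (by linarith) hx (by positivity) (by linarith [sq_nonneg x]) ?_)
  · have hpow : (x ^ 2 / 4) ^ (-α - 1) =
        (x ^ α * x ^ α * x ^ 2)⁻¹ * (2 ^ (α + 1) * 2 ^ (α + 1)) := by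
      rw [show x ^ 2 / 4 = (x / 2) * (x / 2) by ring, Real.mul_rpow (by positivity) (by positivity),
        show -α - 1 = -(α + 1) by ring, Real.rpow_neg (by positivity),
        Real.div_rpow hx.le (by norm_num), Real.rpow_add_one hx.ne']
      field_simp
    have htwo : (2 : ℝ) ≤ 2 ^ (α + 1) := by
      simpa using Real.rpow_le_rpow_of_exponent_le (x := 2) (by norm_num)
        (show (1 : ℝ) ≤ α + 1 by linarith)
    have hxα : 0 < x ^ α := by positivity
    rw [hpow]
    calc Real.exp (-3) / 4 = Real.exp (-3) / 8 * 2 := by ring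
      _ ≤ Real.exp (-3) / 8 * 2 ^ (α + 1) := by gcongr
      _ = _ := by field_simp; ring
  · intro t ht
    have ht0 : 0 < t := lt_of_lt_of_le (by positivity) ht.1
    have hquot : x ^ 2 / (4 * t) ≤ 2 := by
      rw [div_le_iff₀ (by positivity)]
      linarith [ht.1]
    linarith [ht.2]

/-- `x ^ α * besselK α x` is at least a constant times `x ^ (-1 / 2) * exp (-x)` on `[1, ∞)`,
uniformly in `α ∈ [0, 1)`. -/
lemma rpow_mul_besselK_ge_of_one_le {α x : ℝ} (hα : 0 ≤ α) (hα' : α < 1) (hx : 1 ≤ x) :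
    Real.exp (-1 / 2) / 8 * x ^ (-(1 : ℝ) / 2) * Real.exp (-x) ≤ x ^ α * besselK α x := by
  have hx0 : 0 < x := by linarith
  obtain ⟨s, hs, hsx⟩ : ∃ s : ℝ, 1 ≤ s ∧ x = s ^ 2 :=
    ⟨√x, Real.one_le_sqrt.2 hx, (Real.sq_sqrt hx0.le).symm⟩
  have hs0 : 0 < s := by linarith
  refine le_trans ?_ (le_rpow_mul_besselK (a := x / 2) (b := x / 2 + s / 2) (m := x + 1 / 2) hα'
    (by linarith) hx0 (by positivity) (by linarith) ?_)
  · have hb : (x ^ α * x)⁻¹ ≤ (x / 2 + s / 2) ^ (-α - 1) := by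
      rw [← Real.rpow_add_one hx0.ne', ← Real.rpow_neg hx0.le, neg_add']
      exact Real.rpow_le_rpow_of_nonpos (by positivity) (by nlinarith) (by linarith)
    have htwo : (2 : ℝ) ^ (α + 1) ≤ 4 := by
      calc (2 : ℝ) ^ (α + 1) ≤ 2 ^ (2 : ℝ) :=
            Real.rpow_le_rpow_of_exponent_le (by norm_num) (by linarith)
        _ = 4 := by norm_num
    have hxα : 1 ≤ x ^ α := Real.one_le_rpow hx hα
    have hhalf : x ^ (-(1 : ℝ) / 2) = s / x := by
      rw [hsx, ← Real.rpow_natCast, ← Real.rpow_mul hs0.le]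
      norm_num [Real.rpow_neg_one]
      field_simp
    have hexp : Real.exp (-(x + 1 / 2)) = Real.exp (-1 / 2) * Real.exp (-x) := by
      rw [← Real.exp_add]
      ring_nf
    rw [hhalf, hexp, show x / 2 + s / 2 - x / 2 = s / 2 by ring]
    calc Real.exp (-1 / 2) / 8 * (s / x) * Real.exp (-x)
        = 1 * (1 / 4 * (Real.exp (-1 / 2) * Real.exp (-x) * x⁻¹ * (s / 2))) := by
          field_simp; ring
      _ ≤ x ^ α * (1 / 2 ^ (α + 1) * (Real.exp (-1 / 2) * Real.exp (-x) * x⁻¹ * (s / 2))) := by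
          gcongr
      _ = x ^ α * (x ^ α / 2 ^ (α + 1) *
            (Real.exp (-1 / 2) * Real.exp (-x) * (x ^ α * x)⁻¹ * (s / 2))) := by
          field_simp
      _ ≤ _ := by gcongr
  · intro t ht
    have ht0 : 0 < t := lt_of_lt_of_le (by positivity) ht.1
    have hsq : (t - x / 2) ^ 2 ≤ (s / 2) ^ 2 :=
      pow_le_pow_left₀ (by linarith [ht.1]) (by linarith [ht.2]) 2
    have hquot : (t - x / 2) ^ 2 / t ≤ 1 / 2 := by
      rw [div_le_iff₀ ht0]
      nlinarith [ht.1]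
    have hid : t + x ^ 2 / (4 * t) = x + (t - x / 2) ^ 2 / t := by
      field_simp
      ring
    linarith

/-- There is a universal `c₁ ∈ (0, ∞)` such that for every `α₀ ∈ (0, 1/2)` there is
`c₂(α₀) ∈ (0, ∞)` such that for all `α ∈ (0, α₀]`:
(i) `x^α K_α(x) ≥ c₁` for all `x ∈ (0, 2]`, and
(ii) `x^α K_α(x) ≥ c₂(α₀)·x^{−1/2}·e^{−x}` for all `x ∈ [2, ∞)`. -/
theorem hatK_lower_bounds :
    ∃ c₁ : ℝ, 0 < c₁ ∧
      ∀ α₀ : ℝ, 0 < α₀ → α₀ < 1 / 2 →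
        ∃ c₂ : ℝ, 0 < c₂ ∧
          ∀ α : ℝ, 0 < α → α ≤ α₀ →
            (∀ x : ℝ, 0 < x → x ≤ 2 → c₁ ≤ x ^ α * besselK α x) ∧
            (∀ x : ℝ, 2 ≤ x →
              c₂ * x ^ (-(1 : ℝ) / 2) * Real.exp (-x) ≤ x ^ α * besselK α x) := by
  refine ⟨Real.exp (-3) / 4, by positivity, fun α₀ _ hα₀ =>
    ⟨Real.exp (-1 / 2) / 8, by positivity, fun α hα hle => ⟨fun x hx hx2 => ?_, fun x hx => ?_⟩⟩⟩
  · exact rpow_mul_besselK_ge_of_le_two hα.le (by linarith) hx hx2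
  · exact rpow_mul_besselK_ge_of_one_le hα.le (by linarith) (by linarith)
end

section
/- Fix β > 0. Let f : ℝ² → ℝ be twice continuously differentiable on ℝ² ∖ {(0,0)}, and for (x,y) ≠ (0,0) with r = √(x²+y²) set g(x,y) = f(x,y) / K_0(√β·r). Then for all (x,y) ≠ (0,0), Δf(x,y) = K_0(√β·r) · [ Δg(x,y) − 2√β·(K_1(√β·r)/K_0(√β·r))·( (x/r)·∂g/∂x(x,y) + (y/r)·∂g/∂y(x,y) ) ] + β·f(x,y), where Δ = ∂²/∂x² + ∂²/∂y² is the two-dimensional Laplacian. In other words, the Laplacian decomposes on ℝ² ∖ {0} as Δf = K_0(√β|z|)·𝒜^{β↓}[f/K_0(√β|·|)] + βf, where 𝒜^{β↓}h = Δh − 2√β(K_1/K_0)(√β|z|)·((x/|z|)∂_x h + (y/|z|)∂_y h) is the infinitesimal generator of the skew-product diffusion representing the relative motion of the two-dimensional delta-Bose gas. -/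
/-- Partial derivative in the first variable: `∂f/∂x` at `p = (x, y)`. -/
noncomputable def pderiv1 (f : ℝ × ℝ → ℝ) (p : ℝ × ℝ) : ℝ :=
  deriv (fun s => f (s, p.2)) p.1

/-- Partial derivative in the second variable: `∂f/∂y` at `p = (x, y)`. -/
noncomputable def pderiv2 (f : ℝ × ℝ → ℝ) (p : ℝ × ℝ) : ℝ :=
  deriv (fun s => f (p.1, s)) p.2

/-- The two-dimensional Laplacian `Δf = ∂²f/∂x² + ∂²f/∂y²`. -/
noncomputable def lap2 (f : ℝ × ℝ → ℝ) (p : ℝ × ℝ) : ℝ :=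
  pderiv1 (pderiv1 f) p + pderiv2 (pderiv2 f) p

open MeasureTheory Filter Topology Set

/-- The integral `∫_0^∞ exp(-t - u/t) t^(-n) dt`, through which the Macdonald functions of
integer order are expressed. -/
noncomputable def macdonaldIntegral (n : ℕ) (u : ℝ) : ℝ :=
  ∫ t in Ioi (0 : ℝ), Real.exp (-t - u / t) / t ^ n

lemma exp_neg_sub_div_div_pow_le (n : ℕ) {u v t : ℝ} (hu : 0 < u) (huv : u ≤ v) (ht : 0 < t) :
    Real.exp (-t - v / t) / t ^ n ≤ n.factorial / u ^ n * Real.exp (-t) := by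
  have h1 : (u / t) ^ n / n.factorial ≤ Real.exp (u / t) :=
    Real.pow_div_factorial_le_exp _ (by positivity) n
  have h2 : Real.exp (u / t) ≤ Real.exp (v / t) := Real.exp_le_exp.2 (by gcongr)
  have h3 : u ^ n ≤ Real.exp (v / t) * (n.factorial * t ^ n) := by
    have h4 := h1.trans h2
    rw [div_pow, div_div, div_le_iff₀ (by positivity)] at h4
    linarith
  rw [Real.exp_sub, div_div, div_mul_eq_mul_div, div_le_div_iff₀ (by positivity) (by positivity)]
  calc Real.exp (-t) * u ^ n
      ≤ Real.exp (-t) * (Real.exp (v / t) * (n.factorial * t ^ n)) := by gcongr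
    _ = _ := by ring

lemma continuousOn_exp_neg_sub_div_div_pow (n : ℕ) (u : ℝ) :
    ContinuousOn (fun t : ℝ => Real.exp (-t - u / t) / t ^ n) (Ioi 0) := by
  have h : ∀ t ∈ Ioi (0 : ℝ), t ≠ 0 := fun t ht => ne_of_gt ht
  have h' : ∀ t ∈ Ioi (0 : ℝ), t ^ n ≠ 0 := fun t ht => pow_ne_zero n (h t ht)
  fun_prop (disch := assumption)

lemma integrableOn_const_mul_exp_neg (C : ℝ) :
    IntegrableOn (fun t : ℝ => C * Real.exp (-t)) (Ioi 0) :=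
  (integrableOn_exp_neg_Ioi 0).const_mul C

lemma integrableOn_exp_neg_sub_div_div_pow (n : ℕ) {u : ℝ} (hu : 0 < u) :
    IntegrableOn (fun t : ℝ => Real.exp (-t - u / t) / t ^ n) (Ioi 0) := by
  refine (integrableOn_const_mul_exp_neg (n.factorial / u ^ n)).mono'
    ((continuousOn_exp_neg_sub_div_div_pow n u).aestronglyMeasurable measurableSet_Ioi) ?_
  filter_upwards [ae_restrict_mem measurableSet_Ioi] with t ht
  have ht' : 0 < t := ht
  rw [Real.norm_of_nonneg (by positivity)]
  exact exp_neg_sub_div_div_pow_le n hu le_rfl ht'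

lemma macdonaldIntegral_pos (n : ℕ) {u : ℝ} (hu : 0 < u) : 0 < macdonaldIntegral n u := by
  have hpos : ∀ t ∈ Ioi (0 : ℝ), 0 < Real.exp (-t - u / t) / t ^ n := fun t ht => by
    have ht' : 0 < t := ht
    positivity
  rw [macdonaldIntegral, setIntegral_pos_iff_support_of_nonneg_ae
    ((ae_restrict_mem measurableSet_Ioi).mono fun t ht => (hpos t ht).le)
    (integrableOn_exp_neg_sub_div_div_pow n hu),
    inter_eq_self_of_subset_right fun t ht => Function.mem_support.2 (hpos t ht).ne']
  simp

lemma hasDerivAt_macdonaldIntegral (n : ℕ) {u : ℝ} (hu : 0 < u) :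
    HasDerivAt (macdonaldIntegral n) (-macdonaldIntegral (n + 1) u) u := by
  have hball : ∀ v ∈ Metric.ball u (u / 2), u / 2 ≤ v := fun v hv => by
    rw [Metric.mem_ball, Real.dist_eq, abs_lt] at hv
    linarith
  have key := (hasDerivAt_integral_of_dominated_loc_of_deriv_le
    (μ := volume.restrict (Ioi (0 : ℝ)))
    (F := fun v t : ℝ => Real.exp (-t - v / t) / t ^ n)
    (F' := fun v t : ℝ => -(Real.exp (-t - v / t) / t ^ (n + 1))) (x₀ := u)
    (bound := fun t => ((n + 1).factorial / (u / 2) ^ (n + 1) : ℝ) * Real.exp (-t))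
    (Metric.ball_mem_nhds u (half_pos hu))
    (Eventually.of_forall fun v =>
      (continuousOn_exp_neg_sub_div_div_pow n v).aestronglyMeasurable measurableSet_Ioi)
    (integrableOn_exp_neg_sub_div_div_pow n hu)
    ((continuousOn_exp_neg_sub_div_div_pow (n + 1) u).aestronglyMeasurable
      measurableSet_Ioi).neg
    ?_ (integrableOn_const_mul_exp_neg _) ?_).2
  · rwa [integral_neg] at key
  · filter_upwards [ae_restrict_mem measurableSet_Ioi] with t ht v hv
    have ht' : 0 < t := ht
    rw [norm_neg, Real.norm_of_nonneg (by positivity)]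
    exact exp_neg_sub_div_div_pow_le (n + 1) (half_pos hu) (hball v hv) ht'
  · filter_upwards [ae_restrict_mem measurableSet_Ioi] with t ht v _
    have ht' : t ≠ 0 := ne_of_gt ht
    have h := ((((hasDerivAt_id v).div_const t).const_sub (-t)).exp).div_const (t ^ n)
    refine h.congr_deriv ?_
    simp only [id]
    rw [pow_succ]
    field_simp

/-- Integration by parts: `∫_0^∞ d/dt [exp(-t - u/t) / t] dt = 0`. -/
lemma macdonaldIntegral_recurrence {u : ℝ} (hu : 0 < u) :
    u * macdonaldIntegral 3 u = macdonaldIntegral 1 u + macdonaldIntegral 2 u := by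
  have i1 := integrableOn_exp_neg_sub_div_div_pow 1 hu
  have i2 := integrableOn_exp_neg_sub_div_div_pow 2 hu
  have i3 := (integrableOn_exp_neg_sub_div_div_pow 3 hu).const_mul u
  have i31 : IntegrableOn (fun t : ℝ => u * (Real.exp (-t - u / t) / t ^ 3)
      - Real.exp (-t - u / t) / t ^ 1) (Ioi 0) := i3.sub i1
  set F : ℝ → ℝ := fun t => Real.exp (-t - u / t) / t with hF
  have hbound : ∀ t : ℝ, 0 ≤ t → 0 ≤ F t ∧ F t ≤ 2 / u ^ 2 * (t * Real.exp (-t)) := by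
    intro t ht
    refine ⟨by positivity, ?_⟩
    rcases ht.eq_or_lt with rfl | ht
    · simp [hF]
    have h := exp_neg_sub_div_div_pow_le 2 hu le_rfl ht
    calc F t = t * (Real.exp (-t - u / t) / t ^ 2) := by
          simp only [hF]; field_simp
      _ ≤ t * ((Nat.factorial 2 : ℕ) / u ^ 2 * Real.exp (-t)) := by gcongr
      _ = _ := by simp [Nat.factorial]; ring
  have hcont : ContinuousWithinAt F (Ici 0) 0 := by
    have hF0 : F 0 = 0 := by simp [hF]
    rw [ContinuousWithinAt, hF0]
    refine squeeze_zero' (g := fun t => 2 / u ^ 2 * (t * Real.exp (-t)))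
      (eventually_mem_nhdsWithin.mono fun t ht => (hbound t ht).1)
      (eventually_mem_nhdsWithin.mono fun t ht => (hbound t ht).2) ?_
    have : Continuous fun t : ℝ => 2 / u ^ 2 * (t * Real.exp (-t)) := by fun_prop
    simpa using (this.tendsto 0).mono_left nhdsWithin_le_nhds
  have htop : Tendsto F atTop (𝓝 0) := by
    refine squeeze_zero' (g := fun t => 2 / u ^ 2 * (t * Real.exp (-t)))
      ((eventually_ge_atTop 0).mono fun t ht => (hbound t ht).1)
      ((eventually_ge_atTop 0).mono fun t ht => (hbound t ht).2) ?_
    simpa using (Real.tendsto_pow_mul_exp_neg_atTop_nhds_zero 1).const_mul (2 / u ^ 2)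
  have hderiv : ∀ t ∈ Ioi (0 : ℝ), HasDerivAt F
      (u * (Real.exp (-t - u / t) / t ^ 3) - Real.exp (-t - u / t) / t ^ 1
        - Real.exp (-t - u / t) / t ^ 2) t := by
    intro t ht
    have ht' : t ≠ 0 := ne_of_gt ht
    have h := (((hasDerivAt_id t).neg.sub
      ((hasDerivAt_const t u).div (hasDerivAt_id t) ht')).exp).div (hasDerivAt_id t) ht'
    refine h.congr_deriv ?_
    simp only [id, Pi.sub_apply, Pi.neg_apply, Pi.div_apply]
    field_simp
    ring
  have h := integral_Ioi_of_hasDerivAt_of_tendsto hcont hderiv (i31.sub i2) htop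
  rw [integral_sub i31 i2, integral_sub i3 i1, integral_const_mul] at h
  simp only [hF, div_zero, sub_zero] at h
  simp only [macdonaldIntegral]
  linarith

lemma besselK_zero_eq (x : ℝ) : besselK 0 x = macdonaldIntegral 1 (x ^ 2 / 4) / 2 := by
  have h : ∀ t : ℝ, Real.exp (-t - x ^ 2 / (4 * t)) * t ^ (-0 - 1 : ℝ)
      = Real.exp (-t - x ^ 2 / 4 / t) / t ^ 1 := fun t => by
    rw [neg_zero, zero_sub, Real.rpow_neg_one, pow_one, div_div, div_eq_mul_inv _ t]
  simp only [besselK, macdonaldIntegral, h]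
  norm_num
  ring

lemma besselK_one_eq (x : ℝ) : besselK 1 x = x / 4 * macdonaldIntegral 2 (x ^ 2 / 4) := by
  have h : ∀ t ∈ Ioi (0 : ℝ), Real.exp (-t - x ^ 2 / (4 * t)) * t ^ (-1 - 1 : ℝ)
      = Real.exp (-t - x ^ 2 / 4 / t) / t ^ 2 := fun t ht => by
    rw [show (-1 - 1 : ℝ) = -(2 : ℕ) by norm_num, Real.rpow_neg (le_of_lt ht),
      Real.rpow_natCast, div_div, div_eq_mul_inv _ (t ^ 2)]
  rw [besselK, macdonaldIntegral, setIntegral_congr_fun measurableSet_Ioi h]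
  norm_num

/-- The Leibniz rule for the second derivative of `f = k * (f / k)`. -/
lemma deriv_deriv_eq_of_div {f k k' : ℝ → ℝ} {k'' x : ℝ} (hf : ContDiffAt ℝ 2 f x)
    (hk : ∀ᶠ s in 𝓝 x, HasDerivAt k (k' s) s) (hk' : HasDerivAt k' k'' x) (hx : k x ≠ 0) :
    deriv (deriv f) x = k x * deriv (deriv fun s => f s / k s) x
      + 2 * k' x * deriv (fun s => f s / k s) x + f x / k x * k'' := by
  have hkx := hk.self_of_nhds
  have hfd : ∀ᶠ s in 𝓝 x, HasDerivAt f (deriv f s) s :=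
    (hf.eventually (by simp)).mono fun s hs => (hs.differentiableAt (by simp)).hasDerivAt
  have hf' : HasDerivAt (deriv f) (deriv (deriv f) x) x :=
    ((ContDiffAt.derivWithin hf (m := 1) (by norm_num)).differentiableAt (by simp)).hasDerivAt
  have hg : ∀ᶠ s in 𝓝 x, HasDerivAt (fun s => f s / k s)
      ((deriv f s * k s - f s * k' s) / k s ^ 2) s := by
    filter_upwards [hk, hfd, hkx.continuousAt.eventually_ne hx] with s h1 h2 h3
    exact h2.div h1 h3
  have hg' : deriv (fun s => f s / k s) =ᶠ[𝓝 x]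
      fun s => (deriv f s * k s - f s * k' s) / k s ^ 2 := hg.mono fun s hs => hs.deriv
  have hgg := ((hf'.mul hkx).sub (hfd.self_of_nhds.mul hk')).div (hkx.pow 2)
    (pow_ne_zero 2 hx)
  have hgg' : deriv (deriv fun s => f s / k s) x = _ := hg'.deriv_eq.trans hgg.deriv
  rw [hgg', hg'.self_of_nhds]
  simp only [Pi.sub_apply, Pi.mul_apply, Pi.pow_apply]
  field_simp
  ring

lemma hasDerivAt_macdonaldIntegral_comp (n : ℕ) {β c s : ℝ} (hβ : 0 < β)
    (hs : 0 < s ^ 2 + c) :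
    HasDerivAt (fun s => macdonaldIntegral n (β * (s ^ 2 + c) / 4))
      (-(β * s / 2) * macdonaldIntegral (n + 1) (β * (s ^ 2 + c) / 4)) s := by
  have h1 : HasDerivAt (fun s : ℝ => β * (s ^ 2 + c) / 4) (β * s / 2) s := by
    refine ((((hasDerivAt_id s).pow 2).add_const c).const_mul β).div_const 4 |>.congr_deriv ?_
    simp
    ring
  exact ((hasDerivAt_macdonaldIntegral n (by positivity)).comp s h1).congr_deriv (by ring)

/-- The second derivative along a coordinate line of `f = k * (f / k)`, where
`k(s) = K_0(√β √(s² + c))`. -/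
lemma deriv_deriv_eq_macdonaldIntegral {β c x : ℝ} {f : ℝ → ℝ} (hβ : 0 < β)
    (hx : 0 < x ^ 2 + c) (hf : ContDiffAt ℝ 2 f x) :
    deriv (deriv f) x =
      macdonaldIntegral 1 (β * (x ^ 2 + c) / 4) / 2 *
          deriv (deriv fun s => f s / (macdonaldIntegral 1 (β * (s ^ 2 + c) / 4) / 2)) x
        - β * x / 2 * macdonaldIntegral 2 (β * (x ^ 2 + c) / 4) *
          deriv (fun s => f s / (macdonaldIntegral 1 (β * (s ^ 2 + c) / 4) / 2)) x
        + f x / (macdonaldIntegral 1 (β * (x ^ 2 + c) / 4) / 2) *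
          (β ^ 2 * x ^ 2 / 8 * macdonaldIntegral 3 (β * (x ^ 2 + c) / 4)
            - β / 4 * macdonaldIntegral 2 (β * (x ^ 2 + c) / 4)) := by
  have hk : ∀ᶠ s in 𝓝 x, HasDerivAt (fun s => macdonaldIntegral 1 (β * (s ^ 2 + c) / 4) / 2)
      (-(β * s / 4) * macdonaldIntegral 2 (β * (s ^ 2 + c) / 4)) s := by
    have hpos : ∀ᶠ s in 𝓝 x, 0 < s ^ 2 + c :=
      (by fun_prop : ContinuousAt (fun s : ℝ => s ^ 2 + c) x).eventually (lt_mem_nhds hx)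
    filter_upwards [hpos] with s hs
    exact ((hasDerivAt_macdonaldIntegral_comp 1 hβ hs).div_const 2).congr_deriv (by ring)
  have hk' : HasDerivAt (fun s => -(β * s / 4) * macdonaldIntegral 2 (β * (s ^ 2 + c) / 4))
      (β ^ 2 * x ^ 2 / 8 * macdonaldIntegral 3 (β * (x ^ 2 + c) / 4)
        - β / 4 * macdonaldIntegral 2 (β * (x ^ 2 + c) / 4)) x := by
    refine ((((hasDerivAt_id x).const_mul β).div_const 4).neg.mul
      (hasDerivAt_macdonaldIntegral_comp 2 hβ hx)).congr_deriv ?_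
    simp
    ring
  have hne : macdonaldIntegral 1 (β * (x ^ 2 + c) / 4) / 2 ≠ 0 :=
    (half_pos (macdonaldIntegral_pos 1 (by positivity))).ne'
  rw [deriv_deriv_eq_of_div hf hk hk' hne]
  ring

/-- Fix `β > 0`. For `f` twice continuously differentiable on `ℝ² ∖ {(0,0)}` and
`g(x,y) = f(x,y)/K_0(√β·r)` with `r = √(x²+y²)`, one has for all `(x,y) ≠ (0,0)`:
`Δf = K_0(√β r)·[Δg − 2√β (K_1/K_0)(√β r)·((x/r) ∂_x g + (y/r) ∂_y g)] + β f`;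
i.e. the Laplacian decomposes through the generator `𝒜^{β↓}` of the skew-product
diffusion representing the relative motion of the 2d delta-Bose gas. -/
theorem laplacian_decomposition (β : ℝ) (hβ : 0 < β) (f : ℝ × ℝ → ℝ)
    (hf : ContDiffOn ℝ 2 f {p : ℝ × ℝ | p ≠ (0, 0)}) :
    ∀ p : ℝ × ℝ, p ≠ (0, 0) →
      lap2 f p =
        besselK 0 (Real.sqrt β * Real.sqrt (p.1 ^ 2 + p.2 ^ 2)) *
          (lap2 (fun q => f q / besselK 0 (Real.sqrt β * Real.sqrt (q.1 ^ 2 + q.2 ^ 2))) p -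
            2 * Real.sqrt β *
              (besselK 1 (Real.sqrt β * Real.sqrt (p.1 ^ 2 + p.2 ^ 2)) /
                besselK 0 (Real.sqrt β * Real.sqrt (p.1 ^ 2 + p.2 ^ 2))) *
              (p.1 / Real.sqrt (p.1 ^ 2 + p.2 ^ 2) *
                  pderiv1 (fun q => f q /
                    besselK 0 (Real.sqrt β * Real.sqrt (q.1 ^ 2 + q.2 ^ 2))) p +
                p.2 / Real.sqrt (p.1 ^ 2 + p.2 ^ 2) *
                  pderiv2 (fun q => f q /
                    besselK 0 (Real.sqrt β * Real.sqrt (q.1 ^ 2 + q.2 ^ 2))) p)) +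
        β * f p := by
  rintro ⟨x, y⟩ hp
  have hxy : 0 < x ^ 2 + y ^ 2 := by
    by_contra h
    refine hp (Prod.ext ?_ ?_) <;> simp only <;> nlinarith [sq_nonneg x, sq_nonneg y]
  have hr : 0 < Real.sqrt (x ^ 2 + y ^ 2) := Real.sqrt_pos.2 hxy
  have hsq : ∀ a b : ℝ, (Real.sqrt β * Real.sqrt (a ^ 2 + b ^ 2)) ^ 2 / 4
      = β * (a ^ 2 + b ^ 2) / 4 := fun a b => by
    rw [mul_pow, Real.sq_sqrt hβ.le, Real.sq_sqrt (by positivity)]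
  have hfp : ContDiffAt ℝ 2 f (x, y) := hf.contDiffAt (isOpen_ne.mem_nhds hp)
  have hfx : ContDiffAt ℝ 2 (fun s => f (s, y)) x :=
    ContDiffAt.comp x hfp (contDiffAt_id.prodMk contDiffAt_const)
  have hfy : ContDiffAt ℝ 2 (fun s => f (x, s)) y :=
    ContDiffAt.comp y hfp (contDiffAt_const.prodMk contDiffAt_id)
  have ex := deriv_deriv_eq_macdonaldIntegral hβ hxy hfx
  have ey := deriv_deriv_eq_macdonaldIntegral hβ (add_comm (x ^ 2) (y ^ 2) ▸ hxy) hfy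
  simp only [add_comm _ (x ^ 2)] at ey
  have hrec := macdonaldIntegral_recurrence (u := β * (x ^ 2 + y ^ 2) / 4) (by positivity)
  have hpos := macdonaldIntegral_pos 1 (u := β * (x ^ 2 + y ^ 2) / 4) (by positivity)
  simp only [lap2, pderiv1, pderiv2, besselK_zero_eq, besselK_one_eq, hsq]
  rw [ex, ey]
  generalize deriv (deriv fun s => f (s, y) / _) x = gxx
  generalize deriv (deriv fun s => f (x, s) / _) y = gyy
  generalize deriv (fun s => f (s, y) / _) x = gx
  generalize deriv (fun s => f (x, s) / _) y = gy
  have hβs : Real.sqrt β ^ 2 = β := Real.sq_sqrt hβ.le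
  set M₁ := macdonaldIntegral 1 (β * (x ^ 2 + y ^ 2) / 4)
  set M₂ := macdonaldIntegral 2 (β * (x ^ 2 + y ^ 2) / 4)
  set M₃ := macdonaldIntegral 3 (β * (x ^ 2 + y ^ 2) / 4)
  have hdrift : 2 * Real.sqrt β * (Real.sqrt β * Real.sqrt (x ^ 2 + y ^ 2) / 4 * M₂ / (M₁ / 2))
      * (x / Real.sqrt (x ^ 2 + y ^ 2) * gx + y / Real.sqrt (x ^ 2 + y ^ 2) * gy)
      = β * M₂ / M₁ * (x * gx + y * gy) := by
    field_simp
    rw [hβs]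
    ring
  have hlap : β ^ 2 * x ^ 2 / 8 * M₃ - β / 4 * M₂ + (β ^ 2 * y ^ 2 / 8 * M₃ - β / 4 * M₂)
      = β * (M₁ / 2) := by
    linear_combination β / 2 * hrec
  have hzero : f (x, y) / (M₁ / 2) * (β * (M₁ / 2)) = β * f (x, y) := by
    field_simp
  rw [hdrift, ← hzero, ← hlap]
  field_simp
  ring
end
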